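/- arXiv:1705.11116 — 2 statements merged into one kernel-verified Lean document; each statement's English description precedes it below -/
import Mathlib

section
/- Let D be a set of k disks identifying a set P of n points in the plane. Then k ≥ ⌈(1 + √(1 + 4(n−1)))/2⌉; equivalently, n ≤ k² − k + 1. -/
noncomputable section

/-- The Euclidean plane. -/
abbrev Pt : Type := EuclideanSpace ℝ (Fin 2)

/-- A disk: a closed Euclidean ball with nonnegative radius. -/
def IsDisk (D : Set Pt) : Prop :=
  ∃ (c : Pt) (r : ℝ), 0 ≤ r ∧ D = Metric.closedBall c r

/-- A family of disks identifies a finite point set: every point is covered and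
every pair of distinct points is separated by some disk. -/
def Identifies (𝒟 : Finset (Set Pt)) (P : Finset Pt) : Prop :=
  (∀ p ∈ P, ∃ D ∈ 𝒟, p ∈ D) ∧
  (∀ p ∈ P, ∀ q ∈ P, p ≠ q → ∃ D ∈ 𝒟, (p ∈ D ∧ q ∉ D) ∨ (q ∈ D ∧ p ∉ D))

/-- Minimum number of disks needed to identify `P`. -/
def gammaID (P : Finset Pt) : ℕ :=
  sInf {k | ∃ 𝒟 : Finset (Set Pt), 𝒟.card = k ∧ (∀ D ∈ 𝒟, IsDisk D) ∧ Identifies 𝒟 P}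

open Set Metric Filter Topology

/-- Around a point of a circle inside an open set there is a neighbourhood which the circle cuts into
two connected pieces. -/
theorem exists_mem_nhds_isConnected_sides {U : Set ℂ} (hU : IsOpen U) {c a : ℂ} {r : ℝ} (hr : 0 < r)
    (ha : a ∈ sphere c r) (haU : a ∈ U) :
    ∃ B ∈ 𝓝 a, B ⊆ U ∧ IsConnected (B ∩ {x | r < dist x c}) ∧
      IsConnected (B ∩ {x | dist x c < r}) := by
  have hac : dist a c = r := ha
  have hne : a - c ≠ 0 := by
    rw [sub_ne_zero, ← dist_pos, hac]; exact hr
  set φ : ℝ × ℝ → ℂ := fun p => c + (p.1 / r : ℝ) * Complex.exp (p.2 * Complex.I) * (a - c) with hφ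
  have hφc : Continuous φ := by fun_prop
  have hφa : φ (r, 0) = a := by simp [hφ, hr.ne']
  have hdist : ∀ p : ℝ × ℝ, 0 < p.1 → dist (φ p) c = p.1 := by
    intro p hp
    have : ‖a - c‖ = r := by rw [← dist_eq_norm, hac]
    simp only [hφ, dist_eq_norm, add_sub_cancel_left, norm_mul, Complex.norm_exp_ofReal_mul_I, this,
      Complex.norm_real, Real.norm_eq_abs, abs_of_pos (div_pos hp hr)]
    field_simp
  have hnhds : φ ⁻¹' U ∈ 𝓝 ((r, 0) : ℝ × ℝ) :=
    hφc.continuousAt.preimage_mem_nhds (by rw [hφa]; exact hU.mem_nhds haU)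
  obtain ⟨ε₀, hε₀, hball⟩ := Metric.mem_nhds_iff.1 hnhds
  obtain ⟨ε, hε, hεε₀, hεr⟩ : ∃ ε > 0, ε < ε₀ ∧ ε < r :=
    ⟨min ε₀ r / 2, by positivity, by have := min_le_left ε₀ r; have := lt_min hε₀ hr; linarith,
      by have := min_le_right ε₀ r; have := lt_min hε₀ hr; linarith⟩
  have hpos : ∀ p ∈ Ioo (r - ε) (r + ε) ×ˢ Ioo (-ε) ε, 0 < p.1 := by
    rintro ⟨s, t⟩ ⟨h, -⟩
    have := h.1
    dsimp only at *
    linarith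
  have houter : φ '' (Ioo (r - ε) (r + ε) ×ˢ Ioo (-ε) ε) ∩ {x | r < dist x c} =
      φ '' (Ioo r (r + ε) ×ˢ Ioo (-ε) ε) := by
    ext x
    constructor
    · rintro ⟨⟨p, hp, rfl⟩, hx⟩
      rw [mem_ofPred_eq, hdist p (hpos p hp)] at hx
      exact ⟨p, ⟨⟨hx, hp.1.2⟩, hp.2⟩, rfl⟩
    · rintro ⟨p, hp, rfl⟩
      have hp' : p ∈ Ioo (r - ε) (r + ε) ×ˢ Ioo (-ε) ε :=
        ⟨⟨by linarith [hp.1.1], hp.1.2⟩, hp.2⟩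
      exact ⟨⟨p, hp', rfl⟩, by rw [mem_ofPred_eq, hdist p (hpos p hp')]; exact hp.1.1⟩
  have hinner : φ '' (Ioo (r - ε) (r + ε) ×ˢ Ioo (-ε) ε) ∩ {x | dist x c < r} =
      φ '' (Ioo (r - ε) r ×ˢ Ioo (-ε) ε) := by
    ext x
    constructor
    · rintro ⟨⟨p, hp, rfl⟩, hx⟩
      rw [mem_ofPred_eq, hdist p (hpos p hp)] at hx
      exact ⟨p, ⟨⟨hp.1.1, hx⟩, hp.2⟩, rfl⟩
    · rintro ⟨p, hp, rfl⟩
      have hp' : p ∈ Ioo (r - ε) (r + ε) ×ˢ Ioo (-ε) ε :=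
        ⟨⟨hp.1.1, by linarith [hp.1.2]⟩, hp.2⟩
      exact ⟨⟨p, hp', rfl⟩, by rw [mem_ofPred_eq, hdist p (hpos p hp')]; exact hp.1.2⟩
  refine ⟨φ '' (Ioo (r - ε) (r + ε) ×ˢ Ioo (-ε) ε), ?_, ?_, ?_, ?_⟩
  · have h1 : ∀ᶠ x in 𝓝 a, dist x c ∈ Ioo (r - ε) (r + ε) :=
      (continuous_id.dist continuous_const).continuousAt.preimage_mem_nhds
        (Ioo_mem_nhds (by simp [hac, hε]) (by simp [hac, hε]))
    have h2 : ∀ᶠ x in 𝓝 a, ((x - c) / (a - c)).arg ∈ Ioo (-ε) ε := by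
      have hcont : ContinuousAt (fun x : ℂ => ((x - c) / (a - c)).arg) a := by
        refine ContinuousAt.comp (g := Complex.arg) ?_ (by fun_prop)
        apply Complex.continuousAt_arg
        simp [div_self hne]
      exact hcont.preimage_mem_nhds (Ioo_mem_nhds (by simp [div_self hne, hε])
        (by simp [div_self hne, hε]))
    filter_upwards [h1, h2] with x hx1 hx2
    refine ⟨(dist x c, ((x - c) / (a - c)).arg), ⟨hx1, hx2⟩, ?_⟩
    have h := Complex.norm_mul_exp_arg_mul_I ((x - c) / (a - c))
    rw [norm_div, ← dist_eq_norm, ← dist_eq_norm, hac] at h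
    simp only [hφ]
    rw [h]
    field_simp
    ring
  · rintro _ ⟨p, hp, rfl⟩
    apply hball
    rw [mem_ball, Prod.dist_eq, max_lt_iff, Real.dist_eq, Real.dist_eq, abs_lt, abs_lt]
    obtain ⟨⟨h1, h2⟩, h3, h4⟩ := hp
    dsimp only
    refine ⟨⟨?_, ?_⟩, ?_, ?_⟩ <;> linarith
  · rw [houter]
    refine IsConnected.image ?_ _ hφc.continuousOn
    exact (isConnected_Ioo (by linarith)).prod (isConnected_Ioo (by linarith))
  · rw [hinner]
    refine IsConnected.image ?_ _ hφc.continuousOn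
    exact (isConnected_Ioo (by linarith)).prod (isConnected_Ioo (by linarith))

/-- A circle with finitely many points removed is the union of at most `max 1 n` connected arcs,
where `n` is the number of removed points. -/
theorem exists_finset_meeting_arcs {c : ℂ} {r : ℝ} (hr : 0 < r) (F : Finset ℂ)
    (hF : (F : Set ℂ) ⊆ sphere c r) :
    ∃ S : Finset ℂ, S.card ≤ max 1 F.card ∧ (S : Set ℂ) ⊆ sphere c r \ F ∧
      ∀ a ∈ sphere c r \ F, ∃ T : Set ℂ, IsPreconnected T ∧ T ⊆ sphere c r \ F ∧ a ∈ T ∧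
        ∃ s ∈ S, s ∈ T := by
  classical
  have hsph : ∀ x ∈ sphere c r, ∃ θ, circleMap c r θ = x := by
    intro x hx
    rwa [← abs_of_pos hr, ← range_circleMap] at hx
  have hmem : ∀ θ, circleMap c r θ ∈ sphere c r := circleMap_mem_sphere c hr.le
  have hcont := continuous_circleMap c r
  rcases F.eq_empty_or_nonempty with rfl | hne
  · refine ⟨{circleMap c r 0}, by simp, by simp [hr.le], fun a ha => ?_⟩
    refine ⟨range (circleMap c r), isPreconnected_range hcont, ?_, ?_, _,
      Finset.mem_singleton_self _, mem_range_self _⟩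
    · rintro _ ⟨θ, rfl⟩
      exact ⟨hmem θ, by simp⟩
    · exact hsph a ha.1
  set bad : Set ℝ := circleMap c r ⁻¹' F with hbad
  have hclosed : IsClosed bad := F.finite_toSet.isClosed.preimage hcont
  have hnext : ∀ f ∈ F, ∃ θ g, circleMap c r θ = f ∧ θ < g ∧ ∀ t ∈ Ioc θ g, t ∉ bad := by
    intro f hf
    obtain ⟨θ, hθ⟩ := hsph f (hF hf)
    have h1 : ∀ᶠ t in 𝓝[>] θ, circleMap c r t ∉ ((F.erase f : Finset ℂ) : Set ℂ) := by
      refine nhdsWithin_le_nhds (hcont.continuousAt.preimage_mem_nhds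
        ((F.erase f).finite_toSet.isClosed.isOpen_compl.mem_nhds ?_))
      simp [hθ]
    have h2 : ∀ᶠ t in 𝓝[>] θ, t ∈ Ioo θ (θ + 2 * Real.pi) :=
      Ioo_mem_nhdsGT (by linarith [Real.pi_pos])
    have h3 : ∀ᶠ t in 𝓝[>] θ, t ∉ bad := by
      filter_upwards [h1, h2] with t ht1 ht2 ht
      refine ht1 (Finset.mem_erase.2 ⟨fun h => ?_, ht⟩)
      have := eq_of_circleMap_eq hr.ne' (by rw [abs_lt]; constructor <;> linarith [ht2.1, ht2.2])
        (h.trans hθ.symm)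
      exact ht2.1.ne' this
    obtain ⟨g, hg, hg'⟩ := mem_nhdsGT_iff_exists_Ioc_subset.1 h3
    exact ⟨θ, g, hθ, hg, fun t ht => hg' ht⟩
  choose! θ g hθ hlt hgood using hnext
  refine ⟨F.image fun f => circleMap c r (g f), Finset.card_image_le.trans (le_max_right _ _), ?_,
    fun a ha => ?_⟩
  · intro x hx
    obtain ⟨f, hf, rfl⟩ := Finset.mem_image.1 hx
    exact ⟨hmem _, hgood f hf _ ⟨hlt f hf, le_rfl⟩⟩
  obtain ⟨α, rfl⟩ := hsph a ha.1
  have hper : ∀ (n : ℤ) t, circleMap c r (t + n * (2 * Real.pi)) = circleMap c r t := fun n t =>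
    (periodic_circleMap c r).int_mul n t
  have hbelow : (bad ∩ Iic α).Nonempty := by
    obtain ⟨f, hf⟩ := hne
    obtain ⟨n, hn⟩ := exists_int_lt ((α - θ f) / (2 * Real.pi))
    rw [lt_div_iff₀ Real.two_pi_pos] at hn
    refine ⟨θ f + n * (2 * Real.pi), ?_, ?_⟩
    · rw [hbad, mem_preimage, hper, hθ f hf]; exact hf
    · rw [mem_Iic]; linarith
  have hbdd : BddAbove (bad ∩ Iic α) := ⟨α, fun t ht => ht.2⟩
  obtain ⟨hβ, hβα⟩ := (hclosed.inter isClosed_Iic).csSup_mem hbelow hbdd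
  set β := sSup (bad ∩ Iic α) with hβdef
  have hafter : ∀ t ∈ Ioc β α, t ∉ bad := fun t ht h =>
    ht.1.not_ge (le_csSup hbdd ⟨h, ht.2⟩)
  have hβlt : β < α := lt_of_le_of_ne hβα fun h => ha.2 (h ▸ hβ)
  set f := circleMap c r β with hf
  have hfF : f ∈ F := hβ
  obtain ⟨n, hn⟩ : ∃ n : ℤ, β = θ f + n * (2 * Real.pi) := by
    obtain ⟨n, hn⟩ := (circleMap_eq_circleMap_iff c hr.ne').1 ((hθ f hfF).trans hf).symm
    refine ⟨n, ?_⟩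
    have := congrArg Complex.im hn
    simpa using this
  have hafter' : ∀ t ∈ Ioc β (g f + n * (2 * Real.pi)), t ∉ bad := by
    intro t ht hb
    refine hgood f hfF (t - n * (2 * Real.pi)) ⟨by linarith [ht.1], by linarith [ht.2]⟩ ?_
    rw [hbad, mem_preimage, ← hper n, sub_add_cancel]
    exact hb
  refine ⟨circleMap c r '' Ioc β (max α (g f + n * (2 * Real.pi))),
    isPreconnected_Ioc.image _ hcont.continuousOn, ?_, ?_, circleMap c r (g f),
    Finset.mem_image_of_mem _ hfF, ?_⟩
  · rintro _ ⟨t, ht, rfl⟩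
    refine ⟨hmem t, ?_⟩
    rcases le_max_iff.1 ht.2 with h | h
    · exact hafter t ⟨ht.1, h⟩
    · exact hafter' t ⟨ht.1, h⟩
  · exact ⟨α, ⟨hβlt, le_max_left _ _⟩, rfl⟩
  · refine ⟨g f + n * (2 * Real.pi), ⟨?_, le_max_right _ _⟩, hper n _⟩
    linarith [hlt f hfF]

/-- The real functions on the plane that are locally constant on `U` and vanish off `U`. -/
def locConst (U : Set ℂ) : Submodule ℝ (ℂ → ℝ) where
  carrier := {f | (∀ x ∈ U, ∀ᶠ y in 𝓝 x, f y = f x) ∧ ∀ x ∉ U, f x = 0}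
  add_mem' := by
    rintro f g ⟨hf, hf'⟩ ⟨hg, hg'⟩
    refine ⟨fun x hx => ?_, fun x hx => by simp [hf' x hx, hg' x hx]⟩
    filter_upwards [hf x hx, hg x hx] with y h1 h2
    simp [h1, h2]
  zero_mem' := by simp
  smul_mem' := by
    rintro a f ⟨hf, hf'⟩
    refine ⟨fun x hx => ?_, fun x hx => by simp [hf' x hx]⟩
    filter_upwards [hf x hx] with y h
    simp [h]

theorem mem_locConst {U : Set ℂ} {f : ℂ → ℝ} :
    f ∈ locConst U ↔ (∀ x ∈ U, ∀ᶠ y in 𝓝 x, f y = f x) ∧ ∀ x ∉ U, f x = 0 :=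
  Iff.rfl

theorem eq_of_mem_locConst {U T : Set ℂ} {f : ℂ → ℝ} (hf : f ∈ locConst U) (hT : IsPreconnected T)
    (hTU : T ⊆ U) {x y : ℂ} (hx : x ∈ T) (hy : y ∈ T) : f y = f x :=
  hT.induction₂ (fun x y => f y = f x) (fun x hx => nhdsWithin_le_nhds (hf.1 x (hTU hx)))
    (fun _ _ _ _ _ _ h1 h2 => h2.trans h1) (fun _ _ _ _ h => h.symm) hx hy

theorem rank_locConst_univ_le : Module.rank ℝ (locConst univ) ≤ 1 := by
  rw [← Module.rank_self ℝ]
  refine LinearMap.rank_le_of_injective ((LinearMap.proj (0 : ℂ)).comp (locConst univ).subtype) ?_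
  intro f g h
  ext x
  rw [eq_of_mem_locConst f.2 isPreconnected_univ subset_rfl (mem_univ 0) (mem_univ x),
    eq_of_mem_locConst g.2 isPreconnected_univ subset_rfl (mem_univ 0) (mem_univ x)]
  exact h

/-- `f` takes the same constant value on both sides of `C` near `a`. -/
def HasNoJump (C : Set ℂ) (f : ℂ → ℝ) (a : ℂ) : Prop :=
  ∃ v, ∀ᶠ x in 𝓝 a, x ∉ C → f x = v

theorem neBot_nhdsWithin_outside {c a : ℂ} {r : ℝ} (hr : 0 < r) (ha : a ∈ sphere c r) :
    (𝓝[{x | r < dist x c}] a).NeBot := by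
  have h : {x | r < dist x c} = (closedBall c r)ᶜ := by ext; simp
  rw [h, ← mem_closure_iff_nhdsWithin_neBot, closure_compl, interior_closedBall _ hr.ne']
  simp [mem_sphere.1 ha]

theorem neBot_nhdsWithin_inside {c a : ℂ} {r : ℝ} (hr : 0 < r) (ha : a ∈ sphere c r) :
    (𝓝[{x | dist x c < r}] a).NeBot := by
  have h : {x | dist x c < r} = ball c r := rfl
  rw [h, ← mem_closure_iff_nhdsWithin_neBot, closure_ball _ hr.ne']
  exact sphere_subset_closedBall ha

theorem hasNoJump_sphere_iff {f : ℂ → ℝ} {c a : ℂ} {r v w : ℝ} (hr : 0 < r) (ha : a ∈ sphere c r)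
    (hout : ∀ᶠ x in 𝓝 a, r < dist x c → f x = v) (hin : ∀ᶠ x in 𝓝 a, dist x c < r → f x = w) :
    HasNoJump (sphere c r) f a ↔ v = w := by
  have := neBot_nhdsWithin_outside hr ha
  have := neBot_nhdsWithin_inside hr ha
  constructor
  · rintro ⟨u, hu⟩
    obtain ⟨x, h1, h2, h3⟩ :=
      ((hu.filter_mono nhdsWithin_le_nhds).and ((hout.filter_mono nhdsWithin_le_nhds).and
        (self_mem_nhdsWithin (s := {x | r < dist x c}) (a := a)))).exists
    obtain ⟨y, h4, h5, h6⟩ :=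
      ((hu.filter_mono nhdsWithin_le_nhds).and ((hin.filter_mono nhdsWithin_le_nhds).and
        (self_mem_nhdsWithin (s := {x | dist x c < r}) (a := a)))).exists
    rw [← h2 h3, ← h5 h6, h1 (ne_of_gt h3), h4 (ne_of_lt h6)]
  · rintro rfl
    refine ⟨v, ?_⟩
    filter_upwards [hout, hin] with x h1 h2 hx
    exact (lt_or_gt_of_ne (show dist x c ≠ r from hx)).elim h2 h1

/-- A single pair of points on the two sides of a circle near `a` detects the jump at `a` of all
locally constant functions. -/
theorem exists_jump_detectors {U : Set ℂ} (hU : IsOpen U) {c a : ℂ} {r : ℝ} (hr : 0 < r)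
    (ha : a ∈ sphere c r) (haU : a ∈ U) :
    ∃ p q : ℂ, ∀ f ∈ locConst (U \ sphere c r),
      (∀ᶠ x in 𝓝 a, r < dist x c → f x = f p) ∧ ∀ᶠ x in 𝓝 a, dist x c < r → f x = f q := by
  obtain ⟨B, hB, hBU, hout, hin⟩ := exists_mem_nhds_isConnected_sides hU hr ha haU
  obtain ⟨p, hp⟩ := hout.nonempty
  obtain ⟨q, hq⟩ := hin.nonempty
  refine ⟨p, q, fun f hf => ⟨?_, ?_⟩⟩
  · filter_upwards [hB] with x hxB hx
    exact eq_of_mem_locConst hf hout.isPreconnected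
      (fun y hy => ⟨hBU hy.1, ne_of_gt hy.2⟩) hp ⟨hxB, hx⟩
  · filter_upwards [hB] with x hxB hx
    exact eq_of_mem_locConst hf hin.isPreconnected
      (fun y hy => ⟨hBU hy.1, ne_of_lt hy.2⟩) hq ⟨hxB, hx⟩

theorem hasNoJump_iff_of_isPreconnected {U T : Set ℂ} (hU : IsOpen U) {c : ℂ} {r : ℝ} (hr : 0 < r)
    {f : ℂ → ℝ} (hf : f ∈ locConst (U \ sphere c r)) (hT : IsPreconnected T)
    (hTU : T ⊆ sphere c r ∩ U) {x y : ℂ} (hx : x ∈ T) (hy : y ∈ T) :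
    HasNoJump (sphere c r) f x ↔ HasNoJump (sphere c r) f y := by
  refine hT.induction₂ (fun x y => HasNoJump (sphere c r) f x ↔ HasNoJump (sphere c r) f y)
    (fun a ha => ?_) (fun _ _ _ _ _ _ h1 h2 => h1.trans h2) (fun _ _ _ _ h => h.symm) hx hy
  obtain ⟨p, q, h⟩ := exists_jump_detectors hU hr (hTU ha).1 (hTU ha).2
  obtain ⟨hout, hin⟩ := h f hf
  rw [hasNoJump_sphere_iff hr (hTU ha).1 hout hin]
  filter_upwards [nhdsWithin_le_nhds hout.eventually_nhds, nhdsWithin_le_nhds hin.eventually_nhds,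
    self_mem_nhdsWithin] with b h1 h2 hb
  rw [hasNoJump_sphere_iff hr (hTU hb).1 h1 h2]

theorem locConst_indicator_mem {U C : Set ℂ} (hC : IsClosed C) {f : ℂ → ℝ} (hf : f ∈ locConst U) :
    indicator Cᶜ f ∈ locConst (U \ C) := by
  refine ⟨fun x hx => ?_, fun x hx => ?_⟩
  · filter_upwards [hf.1 x hx.1, hC.isOpen_compl.mem_nhds hx.2] with y h1 h2
    rw [indicator_of_mem h2, indicator_of_mem (show x ∈ Cᶜ from hx.2), h1]
  · by_cases h : x ∈ C
    · simp [h]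
    · rw [indicator_of_mem (show x ∈ Cᶜ from h)]
      exact hf.2 x fun hxU => hx ⟨hxU, h⟩

/-- A locally constant function without jumps along a circle extends across the circle. -/
theorem exists_mem_locConst_indicator_eq {U : Set ℂ} (hU : IsOpen U) {c : ℂ} {r : ℝ} (hr : 0 < r)
    {f : ℂ → ℝ} (hf : f ∈ locConst (U \ sphere c r))
    (hjump : ∀ a ∈ sphere c r ∩ U, HasNoJump (sphere c r) f a) :
    ∃ g ∈ locConst U, indicator (sphere c r)ᶜ g = f := by
  classical
  choose! v hv using hjump
  set g : ℂ → ℝ := fun x => if x ∈ sphere c r ∩ U then v x else f x with hg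
  have hg1 : ∀ x ∈ sphere c r ∩ U, g x = v x := fun x hx => if_pos hx
  have hg2 : ∀ x ∉ sphere c r ∩ U, g x = f x := fun x hx => if_neg hx
  refine ⟨g, ⟨fun x hx => ?_, fun x hx => ?_⟩, ?_⟩
  · by_cases hxC : x ∈ sphere c r
    · rw [hg1 x ⟨hxC, hx⟩]
      filter_upwards [hv x ⟨hxC, hx⟩, (hv x ⟨hxC, hx⟩).eventually_nhds, hU.mem_nhds hx]
        with y h1 h2 hyU
      by_cases hyC : y ∈ sphere c r
      · rw [hg1 y ⟨hyC, hyU⟩]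
        have := neBot_nhdsWithin_outside hr hyC
        obtain ⟨z, h3, h4, h5⟩ := ((hv y ⟨hyC, hyU⟩).filter_mono nhdsWithin_le_nhds |>.and
          ((h2.filter_mono nhdsWithin_le_nhds).and
            (self_mem_nhdsWithin (s := {x | r < dist x c}) (a := y)))).exists
        rw [← h3 (ne_of_gt h5), h4 (ne_of_gt h5)]
      · rw [hg2 y fun h => hyC h.1, h1 hyC]
    · rw [hg2 x fun h => hxC h.1]
      filter_upwards [hf.1 x ⟨hx, hxC⟩, isClosed_sphere.isOpen_compl.mem_nhds hxC] with y h1 h2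
      rw [hg2 y fun h => h2 h.1, h1]
  · rw [hg2 x fun h => hx h.2]
    exact hf.2 x fun h => hx h.1
  · ext x
    by_cases hxC : x ∈ sphere c r
    · rw [indicator_of_notMem (by simpa using hxC), hf.2 x fun h => h.2 hxC]
    · rw [indicator_of_mem (by simpa using hxC), hg2 x fun h => hxC h.1]

/-- Cutting an open set along a circle that leaves the set in at most `n` points raises the number of
components by at most `max 1 n`. -/
theorem rank_locConst_diff_sphere_le {U : Set ℂ} (hU : IsOpen U) {c : ℂ} {r : ℝ} (hr : 0 < r)
    (F : Finset ℂ) (hF : (F : Set ℂ) = sphere c r \ U) :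
    Module.rank ℝ (locConst (U \ sphere c r)) ≤
      Module.rank ℝ (locConst U) + (max 1 F.card : ℕ) := by
  obtain ⟨S, hcard, hS, harc⟩ :=
    exists_finset_meeting_arcs hr F (by rw [hF]; exact sdiff_subset)
  have hdiff : sphere c r \ F = sphere c r ∩ U := by rw [hF, sdiff_sdiff_right_self]
  rw [hdiff] at hS harc
  choose! p q hpq using fun a (ha : a ∈ sphere c r ∩ U) => exists_jump_detectors hU hr ha.1 ha.2
  let E : locConst (U \ sphere c r) →ₗ[ℝ] (S → ℝ) :=
    (LinearMap.pi fun s : S =>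
      (LinearMap.proj (R := ℝ) (φ := fun _ : ℂ => ℝ) (p s) -
        LinearMap.proj (R := ℝ) (φ := fun _ : ℂ => ℝ) (q s))) ∘ₗ
      (locConst (U \ sphere c r)).subtype
  let ρ : locConst U →ₗ[ℝ] locConst (U \ sphere c r) :=
    { toFun := fun f => ⟨indicator (sphere c r)ᶜ f, locConst_indicator_mem isClosed_sphere f.2⟩
      map_add' := fun f g => Subtype.ext (indicator_add _ _ _)
      map_smul' := fun a f => Subtype.ext (indicator_const_smul _ a f.1) }
  have hker : LinearMap.ker E ≤ LinearMap.range ρ := by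
    intro f hf
    obtain ⟨g, hg, hgf⟩ := exists_mem_locConst_indicator_eq hU hr f.2 fun a ha => by
      obtain ⟨T, hT, hTU, haT, s, hsS, hsT⟩ := harc a ha
      rw [hasNoJump_iff_of_isPreconnected hU hr f.2 hT hTU haT hsT]
      obtain ⟨hout, hin⟩ := hpq s (hTU hsT) f f.2
      rw [hasNoJump_sphere_iff hr (hTU hsT).1 hout hin, ← sub_eq_zero]
      exact congrFun (LinearMap.mem_ker.1 hf) ⟨s, hsS⟩
    exact ⟨⟨g, hg⟩, Subtype.ext hgf⟩
  have h1 : Module.rank ℝ (LinearMap.range E) ≤ (max 1 F.card : ℕ) := by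
    refine (Submodule.rank_le _).trans ?_
    rw [rank_fun', Fintype.card_coe]
    exact_mod_cast hcard
  have h2 : Module.rank ℝ (LinearMap.ker E) ≤ Module.rank ℝ (locConst U) :=
    (Submodule.rank_mono hker).trans (rank_range_le ρ)
  rw [← LinearMap.rank_range_add_rank_ker E, add_comm]
  exact add_le_add h2 h1

/-- The complement of the circles with the given centers and radii. -/
def circlesCompl (A : Finset (ℂ × ℝ)) : Set ℂ :=
  {x | ∀ q ∈ A, dist x q.1 ≠ q.2}

theorem isOpen_circlesCompl (A : Finset (ℂ × ℝ)) : IsOpen (circlesCompl A) := by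
  have : circlesCompl A = ⋂ q ∈ A, (sphere q.1 q.2)ᶜ := by
    ext
    simp only [circlesCompl, mem_ofPred_eq, mem_iInter, mem_compl_iff, mem_sphere, ne_eq]
  rw [this]
  exact isOpen_biInter_finset fun q _ => isClosed_sphere.isOpen_compl

theorem circlesCompl_cons (a : ℂ × ℝ) (A : Finset (ℂ × ℝ)) (h : a ∉ A) :
    circlesCompl (A.cons a h) = circlesCompl A \ sphere a.1 a.2 := by
  ext x
  simp only [circlesCompl, Finset.forall_mem_cons, mem_ofPred_eq, Set.mem_sdiff, mem_sphere, ne_eq,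
    and_comm]

theorem exists_finset_eq_sphere_inter_sphere {c d : ℂ} {r s : ℝ}
    (hne : (c, r) ≠ (d, s)) :
    ∃ F : Finset ℂ, F.card ≤ 2 ∧ (F : Set ℂ) = sphere c r ∩ sphere d s := by
  by_cases hcd : c = d
  · subst hcd
    refine ⟨∅, by simp, ?_⟩
    symm
    rw [Finset.coe_empty, eq_empty_iff_forall_notMem]
    rintro x ⟨h1, h2⟩
    exact hne (by rw [← mem_sphere.1 h1, ← mem_sphere.1 h2])
  · have hle : (sphere c r ∩ sphere d s).encard ≤ 2 := by
      by_contra! hlt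
      obtain ⟨t, ht, ht3⟩ := exists_subset_encard_eq (Order.add_one_le_of_lt hlt)
      obtain ⟨x, y, z, hxy, hxz, hyz, rfl⟩ := encard_eq_three.1 (ht3.trans (by norm_num))
      have hx := ht (mem_insert x {y, z})
      have hy := ht (mem_insert_of_mem x (mem_insert y {z}))
      have hz := ht (mem_insert_of_mem x (mem_insert_of_mem y (mem_singleton z)))
      rcases EuclideanGeometry.eq_of_dist_eq_of_dist_eq_of_finrank_eq_two
        Complex.finrank_real_complex hcd hxy hx.1 hy.1 hz.1 hx.2 hy.2 hz.2 with h | h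
      · exact hxz h.symm
      · exact hyz h.symm
    have hfin : (sphere c r ∩ sphere d s).Finite := finite_of_encard_le_coe (k := 2) hle
    refine ⟨hfin.toFinset, ?_, by simp⟩
    rw [hfin.encard_eq_coe_toFinset_card] at hle
    exact_mod_cast hle

/-- The complement of `k` circles has at most `k ^ 2 - k + 2` components. -/
theorem rank_locConst_circlesCompl_le {A : Finset (ℂ × ℝ)} (hA : A.Nonempty)
    (hpos : ∀ q ∈ A, 0 < q.2) :
    Module.rank ℝ (locConst (circlesCompl A)) ≤ (A.card * (A.card - 1) + 2 : ℕ) := by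
  classical
  induction hA using Finset.Nonempty.cons_induction with
  | singleton a =>
    have h := rank_locConst_diff_sphere_le isOpen_univ (c := a.1) (hpos a (by simp)) ∅ (by simp)
    have hU : circlesCompl {a} = univ \ sphere a.1 a.2 := by
      ext
      simp only [circlesCompl, Finset.mem_singleton, forall_eq, mem_ofPred_eq, Set.mem_sdiff,
        mem_univ, true_and, mem_sphere, ne_eq]
    rw [hU]
    refine (h.trans (add_le_add_left rank_locConst_univ_le _)).trans ?_
    norm_num
  | cons a A ha hA ih =>
    have hpos' : ∀ q ∈ A, 0 < q.2 := fun q hq => hpos q (Finset.mem_cons_of_mem hq)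
    have hF : ∀ q ∈ A, ∃ F : Finset ℂ, F.card ≤ 2 ∧
        (F : Set ℂ) = sphere a.1 a.2 ∩ sphere q.1 q.2 := fun q hq =>
      exists_finset_eq_sphere_inter_sphere fun h => ha (by rwa [show a = q from h])
    choose! F hFcard hFeq using hF
    have hcard : (A.biUnion F).card ≤ A.card * 2 := Finset.card_biUnion_le_card_mul _ _ _ hFcard
    have hunion : ((A.biUnion F : Finset ℂ) : Set ℂ) = sphere a.1 a.2 \ circlesCompl A := by
      ext x
      simp only [Finset.coe_biUnion, mem_iUnion, circlesCompl, Set.mem_sdiff, mem_ofPred_eq,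
        not_forall, not_not, ne_eq, exists_prop, Finset.mem_coe]
      constructor
      · rintro ⟨q, hq, hx⟩
        rw [← Finset.mem_coe, hFeq q hq] at hx
        exact ⟨hx.1, q, hq, hx.2⟩
      · rintro ⟨hx, q, hq, hxq⟩
        refine ⟨q, hq, ?_⟩
        rw [← Finset.mem_coe, hFeq q hq]
        exact ⟨hx, hxq⟩
    have h := rank_locConst_diff_sphere_le (isOpen_circlesCompl A) (hpos a (by simp)) _ hunion
    rw [circlesCompl_cons]
    refine (h.trans (add_le_add_left (ih hpos') _)).trans ?_
    norm_cast
    rw [Finset.card_cons]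
    obtain ⟨n, hn⟩ : ∃ n, A.card = n + 1 := ⟨A.card - 1, by have := hA.card_pos; omega⟩
    rw [hn] at hcard ⊢
    have hmax : max 1 (A.biUnion F).card ≤ (n + 1) * 2 := by omega
    simp only [Nat.add_sub_cancel]
    nlinarith

/-- Points off the circles that are pairwise separated by the open disks are no more numerous than the
components of the complement of the circles. -/
theorem card_le_rank_locConst {A : Finset (ℂ × ℝ)} {Q : Finset ℂ}
    (hQ : (Q : Set ℂ) ⊆ circlesCompl A)
    (hsep : ∀ x ∈ Q, ∀ y ∈ Q, (∀ q ∈ A, dist x q.1 < q.2 ↔ dist y q.1 < q.2) → x = y) :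
    (Q.card : Cardinal) ≤ Module.rank ℝ (locConst (circlesCompl A)) := by
  classical
  let tr : ℂ → Finset (ℂ × ℝ) := fun x => A.filter fun q => dist x q.1 < q.2
  have htr : Function.Injective fun x : Q => tr x := by
    intro x y hxy
    refine Subtype.ext (hsep x x.2 y y.2 fun q hq => ?_)
    simpa [tr, hq] using Finset.ext_iff.1 hxy q
  have hloc : ∀ x ∈ circlesCompl A, ∀ᶠ y in 𝓝 x, tr y = tr x := by
    intro x hx
    have h : ∀ᶠ y in 𝓝 x, ∀ q ∈ A, (dist y q.1 < q.2 ↔ dist x q.1 < q.2) := by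
      rw [Filter.eventually_all_finset]
      intro q hq
      have hcont : ContinuousAt (fun y => dist y q.1) x := by fun_prop
      rcases lt_or_gt_of_ne (hx q hq) with hlt | hgt
      · filter_upwards [hcont.eventually (Iio_mem_nhds hlt)] with y hy
        exact iff_of_true hy hlt
      · filter_upwards [hcont.eventually (Ioi_mem_nhds hgt)] with y hy
        exact iff_of_false (not_lt_of_gt hy) (not_lt_of_gt hgt)
    filter_upwards [h] with y hy
    exact Finset.filter_congr hy
  let ev : locConst (circlesCompl A) →ₗ[ℝ] (Q → ℝ) :=
    (LinearMap.pi fun x : Q => (LinearMap.proj (x : ℂ) : (ℂ → ℝ) →ₗ[ℝ] ℝ)) ∘ₗ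
      (locConst (circlesCompl A)).subtype
  have hev : Function.Surjective ev := by
    intro g
    let G := Function.extend (fun x : Q => tr x) g 0
    refine ⟨⟨indicator (circlesCompl A) fun x => G (tr x), fun x hx => ?_, fun x hx =>
      indicator_of_notMem hx _⟩, ?_⟩
    · filter_upwards [hloc x hx, (isOpen_circlesCompl A).mem_nhds hx] with y h1 h2
      rw [indicator_of_mem h2, indicator_of_mem hx, h1]
    · ext x
      exact (indicator_of_mem (hQ x.2) fun y => G (tr y)).trans (htr.extend_apply g 0 x)
  rw [← Fintype.card_coe, ← rank_fun' (R := ℝ)]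
  exact LinearMap.rank_le_of_surjective ev hev

/-- A closed disk can be enlarged slightly so that it contains the same points of a given finite set and
none of them lies on its boundary. -/
theorem exists_radius_gt {X : Type*} [PseudoMetricSpace X] (P : Finset X) (c : X) (r : ℝ) :
    ∃ s > r, ∀ x ∈ P, dist x c ≠ s ∧ (dist x c < s ↔ x ∈ closedBall c r) := by
  have h : ∀ᶠ s in 𝓝[>] r, ∀ x ∈ P, dist x c ≠ s ∧ (dist x c < s ↔ x ∈ closedBall c r) := by
    rw [Filter.eventually_all_finset]
    intro x _
    by_cases hx : dist x c ≤ r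
    · filter_upwards [self_mem_nhdsWithin] with s hs
      have hlt : dist x c < s := lt_of_le_of_lt hx hs
      exact ⟨hlt.ne, iff_of_true hlt hx⟩
    · filter_upwards [Ioo_mem_nhdsGT (not_le.1 hx)] with s hs
      exact ⟨hs.2.ne', iff_of_false (not_lt_of_gt hs.2) hx⟩
  obtain ⟨s, hs, hs'⟩ := (h.and self_mem_nhdsWithin).exists
  exact ⟨s, hs', hs⟩

theorem card_add_one_le_of_identifies {P : Finset Pt} (hP : P.Nonempty) {𝒟 : Finset (Set Pt)}
    (hD : ∀ D ∈ 𝒟, IsDisk D) (hI : Identifies 𝒟 P) :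
    P.card + 1 ≤ 𝒟.card * (𝒟.card - 1) + 2 := by
  classical
  have hdata : ∀ D ∈ 𝒟, ∃ (c : Pt) (s : ℝ), 0 < s ∧
      ∀ x ∈ P, dist x c ≠ s ∧ (dist x c < s ↔ x ∈ D) := by
    intro D hDD
    obtain ⟨c, r, hr, rfl⟩ := hD D hDD
    obtain ⟨s, hs, h⟩ := exists_radius_gt P c r
    exact ⟨c, s, hr.trans_lt hs, h⟩
  choose! c s hs hcs using hdata
  let e := Complex.orthonormalBasisOneI.repr.symm
  let A : Finset (ℂ × ℝ) := 𝒟.image fun D => (e (c D), s D)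
  have hA : A.Nonempty := by
    obtain ⟨p, hp⟩ := hP
    obtain ⟨D, hD𝒟, -⟩ := hI.1 p hp
    exact ⟨_, Finset.mem_image_of_mem _ hD𝒟⟩
  have hpos : ∀ q ∈ A, 0 < q.2 := by
    simp only [A, Finset.forall_mem_image]
    exact hs
  obtain ⟨z, hz⟩ : ∃ z : ℂ, ∀ q ∈ A, q.2 < dist z q.1 := by
    have h : ∀ᶠ z in Bornology.cobounded ℂ, ∀ q ∈ A, q.2 < dist z q.1 :=
      (Filter.eventually_all_finset A).2 fun q _ =>
        (tendsto_dist_right_cobounded_atTop q.1).eventually_gt_atTop q.2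
    exact h.exists
  have hmem : ∀ x ∈ P, ∀ D ∈ 𝒟, (dist (e x) (e (c D)) < s D ↔ x ∈ D) := fun x hx D hDD => by
    rw [e.dist_map]
    exact (hcs D hDD x hx).2
  have hzP : ∀ x ∈ P, ¬ ∀ q ∈ A, dist (e x) q.1 < q.2 ↔ dist z q.1 < q.2 := by
    intro x hx h
    obtain ⟨D, hDD, hxD⟩ := hI.1 x hx
    have hq : (e (c D), s D) ∈ A := Finset.mem_image_of_mem _ hDD
    exact lt_asymm (hz _ hq) ((h _ hq).1 ((hmem x hx D hDD).2 hxD))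
  have hz_notMem : z ∉ P.image e := by
    intro h
    obtain ⟨x, hx, rfl⟩ := Finset.mem_image.1 h
    exact hzP x hx fun _ _ => Iff.rfl
  have hrank := (card_le_rank_locConst (A := A) (Q := insert z (P.image e)) ?_ ?_).trans
    (rank_locConst_circlesCompl_le hA hpos)
  · have hle : A.card ≤ 𝒟.card := Finset.card_image_le
    rw [Finset.card_insert_of_notMem hz_notMem, Finset.card_image_of_injective _ e.injective] at hrank
    refine (Nat.cast_le.1 hrank).trans ?_
    gcongr
  · intro x hx q hq
    rcases Finset.mem_insert.1 hx with rfl | hx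
    · exact (hz q hq).ne'
    · obtain ⟨u, hu, rfl⟩ := Finset.mem_image.1 hx
      obtain ⟨D, hDD, rfl⟩ := Finset.mem_image.1 hq
      rw [e.dist_map]
      exact (hcs D hDD u hu).1
  · intro x hx y hy h
    rcases Finset.mem_insert.1 hx with hxz | hx <;> rcases Finset.mem_insert.1 hy with hyz | hy
    · rw [hxz, hyz]
    · obtain ⟨v, hv, rfl⟩ := Finset.mem_image.1 hy
      exact (hzP v hv fun q hq => hxz ▸ (h q hq).symm).elim
    · obtain ⟨u, hu, rfl⟩ := Finset.mem_image.1 hx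
      exact (hzP u hu fun q hq => hyz ▸ h q hq).elim
    · obtain ⟨u, hu, rfl⟩ := Finset.mem_image.1 hx
      obtain ⟨v, hv, rfl⟩ := Finset.mem_image.1 hy
      by_contra hne
      obtain ⟨D, hDD, hsep⟩ := hI.2 u hu v hv fun h => hne (h ▸ rfl)
      have huv := h _ (Finset.mem_image_of_mem _ hDD)
      rw [hmem u hu D hDD, hmem v hv D hDD] at huv
      tauto

/-- If `k` disks identify `n` points then `n ≤ k² - k + 1`; equivalently
`k ≥ ⌈(1 + √(1 + 4(n-1)))/2⌉`. -/
theorem lower_bound_sqrt (P : Finset Pt) (hP : P.Nonempty) (𝒟 : Finset (Set Pt))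
    (hD : ∀ D ∈ 𝒟, IsDisk D) (hI : Identifies 𝒟 P) :
    P.card ≤ 𝒟.card ^ 2 - 𝒟.card + 1 ∧
      ⌈(1 + Real.sqrt (1 + 4 * ((P.card : ℝ) - 1))) / 2⌉ ≤ (𝒟.card : ℤ) := by
  have h := card_add_one_le_of_identifies hP hD hI
  have hk : 1 ≤ 𝒟.card := by
    obtain ⟨p, hp⟩ := hP
    obtain ⟨D, hDD, -⟩ := hI.1 p hp
    exact Finset.card_pos.2 ⟨D, hDD⟩
  rw [Nat.mul_sub_one, ← sq] at h
  refine ⟨by omega, ?_⟩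
  have hsq : 𝒟.card ≤ 𝒟.card ^ 2 := Nat.le_self_pow two_ne_zero _
  have hreal : (P.card : ℝ) + 1 ≤ (𝒟.card : ℝ) ^ 2 - 𝒟.card + 2 := by
    have := (Nat.cast_le (α := ℝ)).2 h
    push_cast [Nat.cast_sub hsq] at this
    exact this
  have hk' : (1 : ℝ) ≤ 𝒟.card := by exact_mod_cast hk
  have hsqrt : Real.sqrt (1 + 4 * ((P.card : ℝ) - 1)) ≤ 2 * 𝒟.card - 1 :=
    Real.sqrt_le_iff.2 ⟨by linarith, by nlinarith⟩
  rw [Int.ceil_le]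
  push_cast
  linarith
end
end

section
/- Let P be a set of n points in ℝ² with no three collinear and no four concyclic. Then P can be identified by at most 2⌈n/6⌉ + 1 disks. -/
noncomputable section

instance : DecidableEq Pt := Classical.decEq _

/-- The linear form with coefficients `a`, `b`, evaluated at `p - o`. -/
def linForm (a b : ℝ) (o p : Pt) : ℝ := a * (p 0 - o 0) + b * (p 1 - o 1)

theorem mem_closedBall_sqrt_iff {c p : Pt} {R : ℝ} (hR : 0 ≤ R) :
    p ∈ Metric.closedBall c (√R) ↔ (p 0 - c 0) ^ 2 + (p 1 - c 1) ^ 2 ≤ R := by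
  rw [Metric.mem_closedBall, EuclideanSpace.dist_eq, Real.sqrt_le_sqrt_iff hR]
  simp [Fin.sum_univ_two, Real.dist_eq, sq_abs]

theorem mem_sphere_sqrt_iff {c p : Pt} {R : ℝ} (hR : 0 ≤ R) :
    p ∈ Metric.sphere c (√R) ↔ (p 0 - c 0) ^ 2 + (p 1 - c 1) ^ 2 = R := by
  rw [Metric.mem_sphere, EuclideanSpace.dist_eq, Real.sqrt_inj (by positivity) hR]
  simp [Fin.sum_univ_two, Real.dist_eq, sq_abs]

/-- A half-plane missing the finite set `P` can be replaced by a disk. -/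
theorem exists_disk_eq_halfPlane (P : Finset Pt) (a b : ℝ) (o : Pt)
    (h : ∀ p ∈ P, linForm a b o p ≠ 0) :
    ∃ D, IsDisk D ∧ ∀ p ∈ P, p ∈ D ↔ 0 < linForm a b o p := by
  obtain ⟨M, hM⟩ : ∃ M : ℝ, ∀ p ∈ P,
      ((p 0 - o 0) ^ 2 + (p 1 - o 1) ^ 2) / (2 * linForm a b o p) ≤ M := by
    obtain ⟨M, hM⟩ := (P.image fun p =>
      ((p 0 - o 0) ^ 2 + (p 1 - o 1) ^ 2) / (2 * linForm a b o p)).bddAbove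
    exact ⟨M, fun p hp => hM (by simpa using ⟨p, hp, rfl⟩)⟩
  set R := max M 0
  have hR : 0 ≤ R := le_max_right _ _
  have hc : (0 : ℝ) ≤ R ^ 2 * (a ^ 2 + b ^ 2) := by positivity
  refine ⟨Metric.closedBall !₂[o 0 + R * a, o 1 + R * b] (√(R ^ 2 * (a ^ 2 + b ^ 2))),
    ⟨_, _, Real.sqrt_nonneg _, rfl⟩, fun p hp => ?_⟩
  rw [mem_closedBall_sqrt_iff hc]
  have key : ∀ z : ℝ, (p 0 - (o 0 + R * a)) ^ 2 + (p 1 - (o 1 + R * b)) ^ 2 - z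
      = (p 0 - o 0) ^ 2 + (p 1 - o 1) ^ 2 - 2 * R * linForm a b o p
        + R ^ 2 * (a ^ 2 + b ^ 2) - z := by
    intro z; unfold linForm; ring
  have hk := key 0
  simp only [Matrix.cons_val_zero, Matrix.cons_val_one]
  constructor
  · intro hle
    by_contra hneg
    have hlt : linForm a b o p < 0 := lt_of_le_of_ne (not_lt.mp hneg) (h p hp)
    have h1 : 0 ≤ R * -linForm a b o p := mul_nonneg hR (by linarith)
    have h2 : (p 0 - o 0) ^ 2 + (p 1 - o 1) ^ 2 ≤ 0 := by nlinarith
    have h3 : p 0 - o 0 = 0 := by nlinarith [sq_nonneg (p 0 - o 0), sq_nonneg (p 1 - o 1)]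
    have h4 : p 1 - o 1 = 0 := by nlinarith [sq_nonneg (p 0 - o 0), sq_nonneg (p 1 - o 1)]
    exact h p hp (by simp [linForm, h3, h4])
  · intro hpos
    have h1 := (hM p hp).trans (le_max_left M 0)
    rw [div_le_iff₀ (by positivity)] at h1
    change _ ≤ R * _ at h1
    nlinarith

/-- Three vectors with the sign pattern of alternating sextants positively span the plane, and
they lie on a circle, described by its power `∑ w i * ‖u i‖ ^ 2` at the origin. -/
theorem exists_weights_of_alternating {a b x y : Fin 3 → ℝ}
    (ha : ∑ i, a i = 0) (hb : ∑ i, b i = 0)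
    (hneg : ∀ i j, i ≠ j → a i * x j + b i * y j < 0) :
    ∃ (w : Fin 3 → ℝ) (c d : ℝ), (∀ i, 0 < w i) ∧ ∑ i, w i = 1 ∧ ∑ i, w i * x i = 0 ∧
      ∑ i, w i * y i = 0 ∧ ∀ i, x i ^ 2 + y i ^ 2 - 2 * (c * x i + d * y i) =
        ∑ j, w j * (x j ^ 2 + y j ^ 2) := by
  have hdet : ∀ i j, i ≠ j → 0 < (a i * b j - a j * b i) * (x i * y j - x j * y i) := by
    intro i j hij
    obtain ⟨l, hli, hlj, hl⟩ : ∃ l, l ≠ i ∧ l ≠ j ∧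
        ∀ f : Fin 3 → ℝ, ∑ m, f m = f i + f j + f l := by
      fin_cases i <;> fin_cases j <;> simp at hij <;>
        [use 2; use 1; use 2; use 0; use 1; use 0] <;>
        simp [Fin.sum_univ_three] <;> intros <;> ring
    rw [hl] at ha hb
    have h1 := hneg l i hli
    have h2 := hneg l j hlj
    have h3 := hneg i j hij
    have h4 := hneg j i hij.symm
    have h5 : -(a j * x i + b j * y i) < a i * x i + b i * y i := by
      have : a l = - a i - a j := by linarith
      have : b l = - b i - b j := by linarith
      simp only [*] at h1; linarith
    have h6 : -(a i * x j + b i * y j) < a j * x j + b j * y j := by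
      have : a l = - a i - a j := by linarith
      have : b l = - b i - b j := by linarith
      simp only [*] at h2; linarith
    nlinarith [mul_lt_mul'' h5 h6 (by linarith) (by linarith)]
  have h01 := hdet 0 1 (by decide)
  have h12 := hdet 1 2 (by decide)
  have h20 := hdet 2 0 (by decide)
  simp only [Fin.sum_univ_three] at *
  set k := a 0 * b 1 - a 1 * b 0 with hk
  have e2 : a 2 = - a 0 - a 1 := by linarith
  have e3 : b 2 = - b 0 - b 1 := by linarith
  rw [show a 1 * b 2 - a 2 * b 1 = k by rw [e2, e3]; ring] at h12
  rw [show a 2 * b 0 - a 0 * b 2 = k by rw [e2, e3]; ring] at h20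
  set w₀ := k * (x 1 * y 2 - x 2 * y 1)
  set w₁ := k * (x 2 * y 0 - x 0 * y 2)
  set w₂ := k * (x 0 * y 1 - x 1 * y 0)
  have hk0 : k ≠ 0 := by rintro h; simp [w₂, h] at h01
  have hw : 0 < w₀ + w₁ + w₂ := by positivity
  have hD : x 1 * y 2 - x 2 * y 1 ≠ 0 := by rintro h; simp [w₀, h] at h12
  have hx : w₀ * x 0 + w₁ * x 1 + w₂ * x 2 = 0 := by simp only [w₀, w₁, w₂]; ring
  have hy : w₀ * y 0 + w₁ * y 1 + w₂ * y 2 = 0 := by simp only [w₀, w₁, w₂]; ring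
  set H := (w₀ * (x 0 ^ 2 + y 0 ^ 2) + w₁ * (x 1 ^ 2 + y 1 ^ 2) +
    w₂ * (x 2 ^ 2 + y 2 ^ 2)) / (w₀ + w₁ + w₂) with hH
  have hH' : H * (w₀ + w₁ + w₂) = w₀ * (x 0 ^ 2 + y 0 ^ 2) + w₁ * (x 1 ^ 2 + y 1 ^ 2) +
    w₂ * (x 2 ^ 2 + y 2 ^ 2) := by rw [hH]; field_simp
  obtain ⟨c, d, h1, h2⟩ : ∃ c d, x 1 ^ 2 + y 1 ^ 2 - 2 * (c * x 1 + d * y 1) = H ∧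
      x 2 ^ 2 + y 2 ^ 2 - 2 * (c * x 2 + d * y 2) = H := by
    set E := x 1 * y 2 - x 2 * y 1 with hE
    have h2E : 2 * E ≠ 0 := mul_ne_zero two_ne_zero hD
    obtain ⟨c, hc⟩ : ∃ c, 2 * E * c =
        (x 1 ^ 2 + y 1 ^ 2 - H) * y 2 - (x 2 ^ 2 + y 2 ^ 2 - H) * y 1 :=
      ⟨_, mul_div_cancel₀ _ h2E⟩
    obtain ⟨d, hd⟩ : ∃ d, 2 * E * d =
        (x 2 ^ 2 + y 2 ^ 2 - H) * x 1 - (x 1 ^ 2 + y 1 ^ 2 - H) * x 2 :=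
      ⟨_, mul_div_cancel₀ _ h2E⟩
    refine ⟨c, d, mul_left_cancel₀ hD ?_, mul_left_cancel₀ hD ?_⟩
    · linear_combination (-(x 1)) * hc - y 1 * hd + (x 1 ^ 2 + y 1 ^ 2 - H) * hE
    · linear_combination (-(x 2)) * hc - y 2 * hd + (x 2 ^ 2 + y 2 ^ 2 - H) * hE
  have h0 : x 0 ^ 2 + y 0 ^ 2 - 2 * (c * x 0 + d * y 0) = H := by
    have : w₀ * (x 0 ^ 2 + y 0 ^ 2 - 2 * (c * x 0 + d * y 0) - H) = 0 := by
      linear_combination (-1 : ℝ) * hH' - w₁ * h1 - w₂ * h2 - 2 * c * hx - 2 * d * hy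
    rcases mul_eq_zero.mp this with h | h
    · exact absurd h h12.ne'
    · linarith
  have hsum : w₀ / (w₀ + w₁ + w₂) * (x 0 ^ 2 + y 0 ^ 2) +
      w₁ / (w₀ + w₁ + w₂) * (x 1 ^ 2 + y 1 ^ 2) +
      w₂ / (w₀ + w₁ + w₂) * (x 2 ^ 2 + y 2 ^ 2) = H := by
    rw [hH]; field_simp
  refine ⟨![w₀ / (w₀ + w₁ + w₂), w₁ / (w₀ + w₁ + w₂), w₂ / (w₀ + w₁ + w₂)],
    c, d, ?_, ?_, ?_, ?_, ?_⟩
  · intro i; fin_cases i <;> simp <;> positivity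
  · simp; field_simp
  · simp; field_simp; linarith
  · simp; field_simp; linarith
  · simp only [Matrix.cons_val_zero, Matrix.cons_val_one, Matrix.cons_val_two, Matrix.tail_cons,
      Matrix.head_cons]
    rw [hsum]
    intro i; fin_cases i <;> assumption

/-- No four distinct points of `P` lie on a circle. -/
def NoFourConcyclic (P : Finset Pt) : Prop :=
  ∀ p ∈ P, ∀ q ∈ P, ∀ s ∈ P, ∀ t ∈ P,
    p ≠ q → p ≠ s → p ≠ t → q ≠ s → q ≠ t → s ≠ t →
    ¬ ∃ (c : Pt) (ρ : ℝ), p ∈ Metric.sphere c ρ ∧ q ∈ Metric.sphere c ρ ∧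
      s ∈ Metric.sphere c ρ ∧ t ∈ Metric.sphere c ρ

theorem pos_of_sum_eq_zero_of_neg {g : Fin 3 → ℝ} (hg : ∑ i, g i = 0) (i : Fin 3)
    (h : ∀ j, j ≠ i → g j < 0) : 0 < g i := by
  rw [Fin.sum_univ_three] at hg
  fin_cases i
  · have := h 1 (by decide); have := h 2 (by decide); simp; linarith
  · have := h 0 (by decide); have := h 2 (by decide); simp; linarith
  · have := h 0 (by decide); have := h 1 (by decide); simp; linarith

theorem sum_linForm_eq_zero {a b : Fin 3 → ℝ} (ha : ∑ i, a i = 0) (hb : ∑ i, b i = 0)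
    (o p : Pt) : ∑ i, linForm (a i) (b i) o p = 0 := by
  simp only [linForm, Finset.sum_add_distrib, ← Finset.sum_mul, ha, hb, zero_mul, add_zero]

/-- Three nonempty classes in alternating sextants have a transversal cut out by a disk. -/
theorem exists_disk_inter_eq_singleton_of_nonempty {P : Finset Pt} (hP : NoFourConcyclic P)
    {a b : Fin 3 → ℝ} (ha : ∑ i, a i = 0) (hb : ∑ i, b i = 0) (o : Pt)
    {Q : Fin 3 → Finset Pt} (hQP : ∀ i, Q i ⊆ P) (hQ : ∀ i, (Q i).Nonempty)
    (hneg : ∀ i j, i ≠ j → ∀ p ∈ Q j, linForm (a i) (b i) o p < 0) :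
    ∃ D, IsDisk D ∧ ∀ i, ∃ q ∈ Q i, ∀ p ∈ Q i, p ∈ D ↔ p = q := by
  have hpos : ∀ i, ∀ p ∈ Q i, 0 < linForm (a i) (b i) o p := fun i p hp =>
    pos_of_sum_eq_zero_of_neg (g := fun i => linForm (a i) (b i) o p)
      (sum_linForm_eq_zero ha hb o p) i fun j hj => hneg j i hj p hp
  have key : ∀ q : Fin 3 → Pt, (∀ i, q i ∈ Q i) → ∃ (w : Fin 3 → ℝ) (c d : ℝ),
      (∀ i, 0 < w i) ∧ ∑ i, w i = 1 ∧ ∑ i, w i * (q i 0 - o 0) = 0 ∧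
      ∑ i, w i * (q i 1 - o 1) = 0 ∧
      ∀ i, (q i 0 - o 0) ^ 2 + (q i 1 - o 1) ^ 2 -
        2 * (c * (q i 0 - o 0) + d * (q i 1 - o 1)) =
        ∑ j, w j * ((q j 0 - o 0) ^ 2 + (q j 1 - o 1) ^ 2) := fun q hq =>
    exists_weights_of_alternating ha hb fun i j hij => hneg i j hij (q j) (hq j)
  choose! w c d hw hw1 hw2 hw3 hw4 using key
  obtain ⟨q, hq, hmin⟩ := (Fintype.piFinset Q).exists_min_image
    (fun q => ∑ j, w q j * ((q j 0 - o 0) ^ 2 + (q j 1 - o 1) ^ 2))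
    (Fintype.piFinset_nonempty.mpr hQ)
  have hqQ := Fintype.mem_piFinset.mp hq
  set H := ∑ j, w q j * ((q j 0 - o 0) ^ 2 + (q j 1 - o 1) ^ 2) with hH
  have hH0 : 0 ≤ H := Finset.sum_nonneg fun j _ => by have := hw q hqQ j; positivity
  have hR : 0 ≤ H + c q ^ 2 + d q ^ 2 := by positivity
  set z : Pt := !₂[o 0 + c q, o 1 + d q] with hz
  have hz0 : z 0 = o 0 + c q := rfl
  have hz1 : z 1 = o 1 + d q := rfl
  have hball : ∀ p, p ∈ Metric.closedBall z (√(H + c q ^ 2 + d q ^ 2)) ↔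
      (p 0 - o 0) ^ 2 + (p 1 - o 1) ^ 2 -
        2 * (c q * (p 0 - o 0) + d q * (p 1 - o 1)) ≤ H := fun p => by
    rw [mem_closedBall_sqrt_iff hR, hz0, hz1]
    constructor <;> intro h <;> linarith
  have hsphere : ∀ p, p ∈ Metric.sphere z (√(H + c q ^ 2 + d q ^ 2)) ↔
      (p 0 - o 0) ^ 2 + (p 1 - o 1) ^ 2 -
        2 * (c q * (p 0 - o 0) + d q * (p 1 - o 1)) = H := fun p => by
    rw [mem_sphere_sqrt_iff hR, hz0, hz1]
    constructor <;> intro h <;> linarith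
  refine ⟨Metric.closedBall z (√(H + c q ^ 2 + d q ^ 2)), ⟨z, _, Real.sqrt_nonneg _, rfl⟩,
    fun i => ⟨q i, hqQ i, fun p hp => ?_⟩⟩
  constructor
  swap
  · rintro rfl
    exact (hball _).mpr (hw4 q hqQ i).le
  intro hpD
  by_contra hne
  rcases ((hball p).mp hpD).lt_or_eq with hlt | heq
  · set q' := Function.update q i p with hq'
    have hq'i : q' i = p := Function.update_self ..
    have hq'Q : ∀ j, q' j ∈ Q j := fun j => by
      rcases eq_or_ne j i with rfl | hj
      · rwa [hq'i]
      · rw [hq', Function.update_of_ne hj]; exact hqQ j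
    have h1 := hmin q' (Fintype.mem_piFinset.mpr hq'Q)
    have h2 : ∑ j, w q' j * ((q' j 0 - o 0) ^ 2 + (q' j 1 - o 1) ^ 2 -
        2 * (c q * (q' j 0 - o 0) + d q * (q' j 1 - o 1))) < ∑ j, w q' j * H := by
      refine Finset.sum_lt_sum (fun j _ => ?_) ⟨i, Finset.mem_univ i, ?_⟩
      · refine mul_le_mul_of_nonneg_left ?_ (hw q' hq'Q j).le
        rcases eq_or_ne j i with rfl | hj
        · rw [hq'i]; exact hlt.le
        · rw [hq', Function.update_of_ne hj]; exact (hw4 q hqQ j).le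
      · rw [hq'i]; exact mul_lt_mul_of_pos_left hlt (hw q' hq'Q i)
    have h3 := hw1 q' hq'Q
    have h4 := hw2 q' hq'Q
    have h5 := hw3 q' hq'Q
    rw [← Finset.sum_mul, h3, one_mul] at h2
    simp only [Fin.sum_univ_three] at h1 h2 h4 h5
    refine lt_irrefl H ?_
    linear_combination h1 + h2 + 2 * c q * h4 + 2 * d q * h5
  · have hdis : ∀ j l, j ≠ l → ∀ s ∈ Q j, ∀ t ∈ Q l, s ≠ t := by
      rintro j l hjl s hs _ ht rfl
      exact lt_asymm (hpos j s hs) (hneg j l hjl s ht)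
    have hpq : ∀ j, q j ≠ p := fun j => by
      rcases eq_or_ne j i with rfl | hj
      · exact Ne.symm hne
      · exact hdis j i hj _ (hqQ j) _ hp
    exact hP _ (hQP 0 (hqQ 0)) _ (hQP 1 (hqQ 1)) _ (hQP 2 (hqQ 2)) _ (hQP i hp)
      (hdis 0 1 (by decide) _ (hqQ 0) _ (hqQ 1)) (hdis 0 2 (by decide) _ (hqQ 0) _ (hqQ 2)) (hpq 0)
      (hdis 1 2 (by decide) _ (hqQ 1) _ (hqQ 2)) (hpq 1) (hpq 2)
      ⟨z, _, (hsphere _).mpr (hw4 q hqQ 0), (hsphere _).mpr (hw4 q hqQ 1),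
        (hsphere _).mpr (hw4 q hqQ 2), (hsphere _).mpr heq⟩

theorem ext_of_coords {p q : Pt} (h₀ : p 0 = q 0) (h₁ : p 1 = q 1) : p = q := by
  ext i
  fin_cases i <;> assumption

theorem exists_disk_inter_pair_of_nonempty {A B : Finset Pt} (hA : A.Nonempty)
    (hB : B.Nonempty) :
    ∃ D, IsDisk D ∧ (∃ q ∈ A, ∀ p ∈ A, p ∈ D ↔ p = q) ∧ ∃ q ∈ B, ∀ p ∈ B, p ∈ D ↔ p = q := by
  obtain ⟨⟨a, b⟩, hab, hmin⟩ := (A ×ˢ B).exists_min_image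
    (fun z => (z.1 0 - z.2 0) ^ 2 + (z.1 1 - z.2 1) ^ 2) (hA.product hB)
  obtain ⟨ha, hb⟩ := Finset.mem_product.mp hab
  have hR : 0 ≤ ((a 0 - b 0) ^ 2 + (a 1 - b 1) ^ 2) / 4 := by positivity
  set z : Pt := !₂[(a 0 + b 0) / 2, (a 1 + b 1) / 2]
  have hz0 : z 0 = (a 0 + b 0) / 2 := rfl
  have hz1 : z 1 = (a 1 + b 1) / 2 := rfl
  have hball : ∀ p, p ∈ Metric.closedBall z (√(((a 0 - b 0) ^ 2 + (a 1 - b 1) ^ 2) / 4)) ↔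
      (p 0 - a 0) * (p 0 - b 0) + (p 1 - a 1) * (p 1 - b 1) ≤ 0 := fun p => by
    rw [mem_closedBall_sqrt_iff hR, hz0, hz1]
    constructor <;> intro h <;> linarith
  have hext : ∀ p q : Pt, (p 0 - q 0) ^ 2 + (p 1 - q 1) ^ 2 ≤ 0 → p = q := fun p q h => by
    have h0 := sq_nonneg (p 0 - q 0)
    have h1 := sq_nonneg (p 1 - q 1)
    exact ext_of_coords (sub_eq_zero.mp (pow_eq_zero_iff two_ne_zero |>.mp (by linarith)))
      (sub_eq_zero.mp (pow_eq_zero_iff two_ne_zero |>.mp (by linarith)))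
  refine ⟨Metric.closedBall z (√(((a 0 - b 0) ^ 2 + (a 1 - b 1) ^ 2) / 4)),
    ⟨z, _, Real.sqrt_nonneg _, rfl⟩, ⟨a, ha, fun p hp => ⟨fun h => ?_, ?_⟩⟩,
    ⟨b, hb, fun p hp => ⟨fun h => ?_, ?_⟩⟩⟩
  · have h1 := hmin (p, b) (Finset.mk_mem_product hp hb)
    have h2 := (hball p).mp h
    simp only at h1
    exact hext _ _ (by linarith)
  · rintro rfl
    exact (hball p).mpr (by simp)
  · have h1 := hmin (a, p) (Finset.mk_mem_product ha hp)
    have h2 := (hball p).mp h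
    simp only at h1
    exact hext _ _ (by linarith)
  · rintro rfl
    exact (hball p).mpr (by simp)

theorem exists_disk_inter_pair (A B : Finset Pt) :
    ∃ D, IsDisk D ∧ (A.Nonempty → ∃ q ∈ A, ∀ p ∈ A, p ∈ D ↔ p = q) ∧
      (B.Nonempty → ∃ q ∈ B, ∀ p ∈ B, p ∈ D ↔ p = q) := by
  rcases A.eq_empty_or_nonempty with rfl | hA
  · rcases B.eq_empty_or_nonempty with rfl | hB
    · exact ⟨_, ⟨0, 0, le_rfl, rfl⟩, by simp, by simp⟩
    · obtain ⟨D, hD, h, -⟩ := exists_disk_inter_pair_of_nonempty hB hB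
      exact ⟨D, hD, by simp, fun _ => h⟩
  · rcases B.eq_empty_or_nonempty with rfl | hB
    · obtain ⟨D, hD, h, -⟩ := exists_disk_inter_pair_of_nonempty hA hA
      exact ⟨D, hD, fun _ => h, by simp⟩
    · obtain ⟨D, hD, h, h'⟩ := exists_disk_inter_pair_of_nonempty hA hB
      exact ⟨D, hD, fun _ => h, fun _ => h'⟩

/-- Three classes in alternating sextants: some disk cuts out exactly one point of every
nonempty class. -/
theorem exists_disk_inter_eq_singleton {P : Finset Pt} (hP : NoFourConcyclic P)
    {a b : Fin 3 → ℝ} (ha : ∑ i, a i = 0) (hb : ∑ i, b i = 0) (o : Pt)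
    {Q : Fin 3 → Finset Pt} (hQP : ∀ i, Q i ⊆ P)
    (hneg : ∀ i j, i ≠ j → ∀ p ∈ Q j, linForm (a i) (b i) o p < 0) :
    ∃ D, IsDisk D ∧ ∀ i, (Q i).Nonempty → ∃ q ∈ Q i, ∀ p ∈ Q i, p ∈ D ↔ p = q := by
  by_cases hQ : ∀ i, (Q i).Nonempty
  · obtain ⟨D, hD, h⟩ := exists_disk_inter_eq_singleton_of_nonempty hP ha hb o hQP hQ hneg
    exact ⟨D, hD, fun i _ => h i⟩
  · push Not at hQ
    obtain ⟨l, hl⟩ := hQ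
    obtain ⟨i, j, hij⟩ : ∃ i j : Fin 3, ∀ m, m = l ∨ m = i ∨ m = j := by
      clear hl
      revert l
      decide
    obtain ⟨D, hD, h, h'⟩ := exists_disk_inter_pair (Q i) (Q j)
    refine ⟨D, hD, fun m => ?_⟩
    rcases hij m with rfl | rfl | rfl
    · simp [hl]
    · exact h
    · exact h'

/-- Disks separating the points inside each of three classes in alternating sextants. -/
theorem exists_disks_separating_classes {P : Finset Pt} (hP : NoFourConcyclic P)
    {a b : Fin 3 → ℝ} (ha : ∑ i, a i = 0) (hb : ∑ i, b i = 0) (o : Pt) (k : ℕ)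
    {Q : Fin 3 → Finset Pt} (hQP : ∀ i, Q i ⊆ P) (hcard : ∀ i, (Q i).card ≤ k + 1)
    (hneg : ∀ i j, i ≠ j → ∀ p ∈ Q j, linForm (a i) (b i) o p < 0) :
    ∃ 𝒟 : Finset (Set Pt), 𝒟.card ≤ k ∧ (∀ D ∈ 𝒟, IsDisk D) ∧
      ∀ i, ∀ p ∈ Q i, ∀ q ∈ Q i, p ≠ q →
        ∃ D ∈ 𝒟, (p ∈ D ∧ q ∉ D) ∨ (q ∈ D ∧ p ∉ D) := by
  classical
  induction k generalizing Q with
  | zero =>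
    exact ⟨∅, by simp, by simp, fun i p hp q hq hpq =>
      absurd (Finset.card_le_one.mp (hcard i) p hp q hq) hpq⟩
  | succ k ih =>
    obtain ⟨D, hD, h⟩ := exists_disk_inter_eq_singleton hP ha hb o hQP hneg
    obtain ⟨𝒟, h𝒟, hdisk, hsep⟩ := ih (Q := fun i => (Q i).filter (· ∉ D))
      (fun i => (Finset.filter_subset _ _).trans (hQP i))
      (fun i => by
        rcases (Q i).eq_empty_or_nonempty with hi | hi
        · simp [hi]
        · obtain ⟨q, hq, hqD⟩ := h i hi
          have : (Q i).filter (· ∉ D) ⊂ Q i :=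
            Finset.filter_ssubset.mpr ⟨q, hq, not_not.mpr ((hqD q hq).mpr rfl)⟩
          have := Finset.card_lt_card this
          have := hcard i
          omega)
      (fun i j hij p hp => hneg i j hij p (Finset.filter_subset _ _ hp))
    refine ⟨insert D 𝒟, (Finset.card_insert_le _ _).trans (by omega),
      fun E hE => ?_, fun i p hp q hq hpq => ?_⟩
    · rcases Finset.mem_insert.mp hE with rfl | hE
      exacts [hD, hdisk E hE]
    · obtain ⟨r, -, hr⟩ := h i ⟨p, hp⟩
      by_cases hpD : p ∈ D <;> by_cases hqD : q ∈ D
      · exact absurd (((hr p hp).mp hpD).trans ((hr q hq).mp hqD).symm) hpq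
      · exact ⟨D, by simp, Or.inl ⟨hpD, hqD⟩⟩
      · exact ⟨D, by simp, Or.inr ⟨hqD, hpD⟩⟩
      · obtain ⟨E, hE, hE'⟩ := hsep i p (by simp [hp, hpD]) q (by simp [hq, hqD]) hpq
        exact ⟨E, by simp [hE], hE'⟩

/-- The points of `P` at which exactly the `i`-th of three linear forms is positive. -/
def sextant (a b : Fin 3 → ℝ) (o : Pt) (P : Finset Pt) (i : Fin 3) : Finset Pt :=
  P.filter fun p => ∀ j, 0 < linForm (a j) (b j) o p ↔ j = i

theorem linForm_neg (a b : ℝ) (o p : Pt) : linForm (-a) (-b) o p = -linForm a b o p := by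
  unfold linForm; ring

theorem exists_pos_iff_or_exists_neg_iff {g : Fin 3 → ℝ} (hg : ∑ i, g i = 0)
    (h : ∀ i, g i ≠ 0) : (∃ i, ∀ j, 0 < g j ↔ j = i) ∨ ∃ i, ∀ j, 0 < -g j ↔ j = i := by
  rw [Fin.sum_univ_three] at hg
  simp only [Fin.forall_fin_succ, Fin.exists_fin_succ, IsEmpty.forall_iff,
    IsEmpty.exists_iff] at *
  simp only [Fin.succ_zero_eq_one, Fin.succ_one_eq_two] at *
  obtain ⟨h0, h1, h2, -⟩ := h
  rcases lt_or_gt_of_ne h0 with h0 | h0 <;> rcases lt_or_gt_of_ne h1 with h1 | h1 <;>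
    rcases lt_or_gt_of_ne h2 with h2 | h2 <;>
    simp [h0, h1, h2, h0.le, h1.le, h2.le] <;> linarith

theorem sextant_subset (a b : Fin 3 → ℝ) (o : Pt) (P : Finset Pt) (i : Fin 3) :
    sextant a b o P i ⊆ P := Finset.filter_subset _ _

theorem exists_mem_sextant {a b : Fin 3 → ℝ} (ha : ∑ i, a i = 0) (hb : ∑ i, b i = 0) {o : Pt}
    {P : Finset Pt} (hne : ∀ i, ∀ p ∈ P, linForm (a i) (b i) o p ≠ 0) {p : Pt} (hp : p ∈ P) :
    (∃ i, p ∈ sextant a b o P i) ∨ ∃ i, p ∈ sextant (-a) (-b) o P i := by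
  simpa [sextant, hp, linForm_neg] using
    exists_pos_iff_or_exists_neg_iff (sum_linForm_eq_zero ha hb o p) fun i => hne i p hp

theorem exists_disks_separating_sextants {P : Finset Pt} (hP : NoFourConcyclic P)
    {a b : Fin 3 → ℝ} (ha : ∑ i, a i = 0) (hb : ∑ i, b i = 0) {o : Pt}
    (hne : ∀ i, ∀ p ∈ P, linForm (a i) (b i) o p ≠ 0) {s : ℕ}
    (hs : ∀ i, (sextant a b o P i).card ≤ s + 1) :
    ∃ 𝒟 : Finset (Set Pt), 𝒟.card ≤ s ∧ (∀ D ∈ 𝒟, IsDisk D) ∧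
      ∀ i, ∀ p ∈ sextant a b o P i, ∀ q ∈ sextant a b o P i, p ≠ q →
        ∃ D ∈ 𝒟, (p ∈ D ∧ q ∉ D) ∨ (q ∈ D ∧ p ∉ D) := by
  refine exists_disks_separating_classes hP ha hb o s (sextant_subset a b o P) hs
    fun i j hij p hp => ?_
  obtain ⟨hpP, hp⟩ := Finset.mem_filter.mp hp
  exact lt_of_le_of_ne (not_lt.mp fun h => hij ((hp i).mp h)) (hne i p hpP)

theorem exists_identifying_of_sextant_card_le {P : Finset Pt} (hP : NoFourConcyclic P)
    {a b : Fin 3 → ℝ} (ha : ∑ i, a i = 0) (hb : ∑ i, b i = 0) {o : Pt}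
    (hne : ∀ i, ∀ p ∈ P, linForm (a i) (b i) o p ≠ 0) {s t : ℕ}
    (hs : ∀ i, (sextant a b o P i).card ≤ s + 1)
    (ht : ∀ i, (sextant (-a) (-b) o P i).card ≤ t + 1) :
    ∃ 𝒟 : Finset (Set Pt), (∀ D ∈ 𝒟, IsDisk D) ∧ Identifies 𝒟 P ∧ 𝒟.card ≤ s + t + 3 := by
  classical
  obtain ⟨𝒮, h𝒮, hS, hSsep⟩ := exists_disks_separating_sextants hP ha hb hne hs
  obtain ⟨𝒯, h𝒯, hT, hTsep⟩ := exists_disks_separating_sextants (a := -a) (b := -b) (o := o) hP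
    (by simpa using ha) (by simpa using hb)
    (fun i p hp => by simpa [linForm_neg] using hne i p hp) ht
  choose D hD hmem using fun i => exists_disk_eq_halfPlane P (a i) (b i) o (hne i)
  have hDmem : ∀ i, D i ∈ Finset.univ.image D ∪ (𝒮 ∪ 𝒯) := fun i =>
    Finset.mem_union_left _ (Finset.mem_image_of_mem D (Finset.mem_univ i))
  refine ⟨Finset.univ.image D ∪ (𝒮 ∪ 𝒯), fun E hE => ?_, ⟨fun p hp => ?_,
    fun p hp q hq hpq => ?_⟩, ?_⟩
  · simp only [Finset.mem_union, Finset.mem_image, Finset.mem_univ, true_and] at hE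
    rcases hE with ⟨i, rfl⟩ | hE | hE
    exacts [hD i, hS E hE, hT E hE]
  · by_contra! hcov
    have hnon : ∀ i, linForm (a i) (b i) o p < 0 := fun i =>
      lt_of_le_of_ne (not_lt.mp fun h => hcov (D i) (hDmem i) ((hmem i p hp).mpr h)) (hne i p hp)
    exact (Finset.sum_neg (fun i _ => hnon i) Finset.univ_nonempty).ne
      (sum_linForm_eq_zero ha hb o p)
  · by_cases hsign : ∀ i, 0 < linForm (a i) (b i) o p ↔ 0 < linForm (a i) (b i) o q
    · rcases exists_mem_sextant ha hb hne hp with ⟨i, hi⟩ | ⟨i, hi⟩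
      · have hi' : q ∈ sextant a b o P i := by
          simp only [sextant, Finset.mem_filter] at hi ⊢
          exact ⟨hq, fun j => (hsign j).symm.trans (hi.2 j)⟩
        obtain ⟨E, hE, hE'⟩ := hSsep i p hi q hi' hpq
        exact ⟨E, by simp [hE], hE'⟩
      · have hsign' : ∀ j, 0 < -linForm (a j) (b j) o p ↔ 0 < -linForm (a j) (b j) o q :=
          fun j => by
            have := hne j p hp
            have := hne j q hq
            have := hsign j
            grind
        have hi' : q ∈ sextant (-a) (-b) o P i := by
          simp only [sextant, Finset.mem_filter, Pi.neg_apply, linForm_neg] at hi ⊢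
          exact ⟨hq, fun j => (hsign' j).symm.trans (hi.2 j)⟩
        obtain ⟨E, hE, hE'⟩ := hTsep i p hi q hi' hpq
        exact ⟨E, by simp [hE], hE'⟩
    · push Not at hsign
      obtain ⟨i, hi⟩ := hsign
      refine ⟨D i, hDmem i, ?_⟩
      rw [hmem i p hp, hmem i q hq]
      simpa [and_comm] using hi
  · have h1 := Finset.card_union_le (Finset.univ.image D) (𝒮 ∪ 𝒯)
    have h2 := Finset.card_union_le 𝒮 𝒯
    have h3 : (Finset.univ.image D).card ≤ 3 := Finset.card_image_le
    omega

theorem exists_identifying_of_sextant_eq_empty {P : Finset Pt} (hP : NoFourConcyclic P)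
    {a b : Fin 3 → ℝ} (ha : ∑ i, a i = 0) (hb : ∑ i, b i = 0) {o : Pt}
    (hne : ∀ i, ∀ p ∈ P, linForm (a i) (b i) o p ≠ 0) {t : ℕ}
    (hs : ∀ i, sextant a b o P i = ∅)
    (ht : ∀ i, (sextant (-a) (-b) o P i).card ≤ t + 1) :
    ∃ 𝒟 : Finset (Set Pt), (∀ D ∈ 𝒟, IsDisk D) ∧ Identifies 𝒟 P ∧ 𝒟.card ≤ t + 2 := by
  classical
  obtain ⟨𝒯, h𝒯, hT, hTsep⟩ := exists_disks_separating_sextants (a := -a) (b := -b) (o := o) hP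
    (by simpa using ha) (by simpa using hb)
    (fun i p hp => by simpa [linForm_neg] using hne i p hp) ht
  choose D hD hmem using fun i => exists_disk_eq_halfPlane P (a i) (b i) o (hne i)
  have hmemT : ∀ p ∈ P, ∃ i, p ∈ sextant (-a) (-b) o P i := fun p hp => by
    simpa [hs] using exists_mem_sextant ha hb hne hp
  have hDT : ∀ i, ∀ p ∈ sextant (-a) (-b) o P i, ∀ j, p ∈ D j ↔ j ≠ i := fun i p hp j => by
    simp only [sextant, Finset.mem_filter, Pi.neg_apply, linForm_neg] at hp
    have := hne j p hp.1
    have := hp.2 j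
    rw [hmem j p hp.1]
    grind
  refine ⟨insert (D 0) (insert (D 1) 𝒯), fun E hE => ?_, ⟨fun p hp => ?_,
    fun p hp q hq hpq => ?_⟩, ?_⟩
  · simp only [Finset.mem_insert] at hE
    rcases hE with rfl | rfl | hE
    exacts [hD 0, hD 1, hT E hE]
  · obtain ⟨i, hi⟩ := hmemT p hp
    have h0 := hDT i p hi 0
    have h1 := hDT i p hi 1
    by_cases h : i = 0
    · exact ⟨D 1, by simp, h1.mpr (by simp [h])⟩
    · exact ⟨D 0, by simp, h0.mpr (Ne.symm h)⟩
  · obtain ⟨i, hi⟩ := hmemT p hp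
    obtain ⟨j, hj⟩ := hmemT q hq
    by_cases hij : i = j
    · subst hij
      obtain ⟨E, hE, hE'⟩ := hTsep i p hi q hj hpq
      exact ⟨E, by simp [hE], hE'⟩
    · by_cases h0 : i = 0 ∨ j = 0
      · refine ⟨D 0, by simp, ?_⟩
        rw [hDT i p hi, hDT j q hj]
        grind
      · refine ⟨D 1, by simp, ?_⟩
        rw [hDT i p hi, hDT j q hj]
        omega
  · have h1 := Finset.card_insert_le (D 0) (insert (D 1) 𝒯)
    have h2 := Finset.card_insert_le (D 1) 𝒯
    omega

/-- If the alternating sextants of three concurrent lines hold at most `s`, respectively `t`,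
points each, then `s + t + 1` disks suffice. -/
theorem exists_identifying_of_sextants {P : Finset Pt} (hP : NoFourConcyclic P)
    {a b : Fin 3 → ℝ} (ha : ∑ i, a i = 0) (hb : ∑ i, b i = 0) {o : Pt}
    (hne : ∀ i, ∀ p ∈ P, linForm (a i) (b i) o p ≠ 0) {s t : ℕ} (hst : 0 < s + t)
    (hs : ∀ i, (sextant a b o P i).card ≤ s)
    (ht : ∀ i, (sextant (-a) (-b) o P i).card ≤ t) :
    ∃ 𝒟 : Finset (Set Pt), (∀ D ∈ 𝒟, IsDisk D) ∧ Identifies 𝒟 P ∧ 𝒟.card ≤ s + t + 1 := by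
  rcases s with _ | s
  · obtain ⟨t, rfl⟩ : ∃ u, t = u + 1 := ⟨t - 1, by omega⟩
    obtain ⟨𝒟, h, h', hc⟩ := exists_identifying_of_sextant_eq_empty hP ha hb hne
      (fun i => Finset.card_eq_zero.mp (Nat.le_zero.mp (hs i))) ht
    exact ⟨𝒟, h, h', by omega⟩
  rcases t with _ | t
  · obtain ⟨𝒟, h, h', hc⟩ := exists_identifying_of_sextant_eq_empty (a := -a) (b := -b) (o := o) hP
      (by simpa using ha) (by simpa using hb)
      (fun i p hp => by simpa [linForm_neg] using hne i p hp)
      (fun i => Finset.card_eq_zero.mp (Nat.le_zero.mp (ht i))) (by simpa using hs)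
    exact ⟨𝒟, h, h', by omega⟩
  · obtain ⟨𝒟, h, h', hc⟩ := exists_identifying_of_sextant_card_le hP ha hb hne hs ht
    exact ⟨𝒟, h, h', by omega⟩

section Configuration

variable {ι : Type*}

/-- The abscissa at which the line through the points `v` and `w` of the planar configuration
`(x, y)` meets the horizontal line at height `h`. -/
def cut (x y : ι → ℝ) (v w : ι) (h : ℝ) : ℝ :=
  (x v * (h - y w) + x w * (y v - h)) / (y v - y w)

/-- The oriented area of the triangle `i`, `j`, `l` of the configuration `(x, y)`, doubled. -/
def cross (x y : ι → ℝ) (i j l : ι) : ℝ :=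
  (x j - x i) * (y l - y i) - (x l - x i) * (y j - y i)

/-- The point `(a, h)` sees all but fewer than `k` points above it crossing more than `k` points
below it at positions in `S`. -/
def Reach (x y : ι → ℝ) (k : ℕ) (h : ℝ) (S : Set ℝ) : Prop :=
  ∃ M W : Finset ι, M.card < k ∧ k < W.card ∧ (∀ w ∈ W, y w ≤ h) ∧
    ∀ v ∉ M, ∀ w ∈ W, h < y v → cut x y v w h ∈ S

/-- At height `h` two large systems of segments cross in opposite order. -/
def IsTwisted (x y : ι → ℝ) (k : ℕ) (h : ℝ) : Prop :=
  ∃ M W M' W' : Finset ι, M.card < k ∧ k < W.card ∧ M'.card < k ∧ k < W'.card ∧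
    (∀ w ∈ W, y w ≤ h) ∧ (∀ w ∈ W', y w ≤ h) ∧
    ∀ v ∉ M, ∀ w ∈ W, ∀ v' ∉ M', ∀ w' ∈ W', h < y v → h < y v' →
      cut x y v w h ≤ cut x y v' w' h

theorem cut_comm (x y : ι → ℝ) (v w : ι) (h : ℝ) : cut x y v w h = cut x y w v h := by
  unfold cut
  rw [← neg_div_neg_eq]
  congr 1 <;> ring

theorem cut_neg (x y : ι → ℝ) (v w : ι) (h : ℝ) : cut x (-y) v w (-h) = cut x y v w h := by
  unfold cut
  rw [← neg_div_neg_eq]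
  simp only [Pi.neg_apply]
  congr 1 <;> ring

theorem continuous_cut (x y : ι → ℝ) (v w : ι) : Continuous (cut x y v w) := by
  unfold cut
  fun_prop

theorem cut_le_iff {x y : ι → ℝ} {v w : ι} {h : ℝ} (hw : y w < h) (hv : h < y v) (a : ℝ) :
    cut x y v w h ≤ a ↔ (x v - a) / (y v - h) ≤ (x w - a) / (y w - h) := by
  have h1 : 0 < y v - h := sub_pos.mpr hv
  have h2 : 0 < h - y w := sub_pos.mpr hw
  have h3 : 0 < y v - y w := by linarith
  rw [cut, div_le_iff₀ h3, ← neg_div_neg_eq (x w - a), neg_sub (y w), div_le_div_iff₀ h1 h2]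
  constructor <;> intro h <;> linarith

theorem le_cut_iff {x y : ι → ℝ} {v w : ι} {h : ℝ} (hw : y w < h) (hv : h < y v) (a : ℝ) :
    a ≤ cut x y v w h ↔ (x w - a) / (y w - h) ≤ (x v - a) / (y v - h) := by
  have h1 : 0 < y v - h := sub_pos.mpr hv
  have h2 : 0 < h - y w := sub_pos.mpr hw
  have h3 : 0 < y v - y w := by linarith
  rw [cut, le_div_iff₀ h3, ← neg_div_neg_eq (x w - a), neg_sub (y w), div_le_div_iff₀ h2 h1]
  constructor <;> intro h <;> linarith

theorem cut_eq_of_div_eq {x y : ι → ℝ} {i j : ι} {a h : ℝ} (hij : y i ≠ y j) (hi : y i ≠ h)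
    (hj : y j ≠ h) (heq : (x i - a) / (y i - h) = (x j - a) / (y j - h)) :
    cut x y i j h = a := by
  rw [div_eq_div_iff (sub_ne_zero.mpr hi) (sub_ne_zero.mpr hj)] at heq
  rw [cut, div_eq_iff (sub_ne_zero.mpr hij)]
  linarith

theorem cross_eq_zero_of_cut_eq {x y : ι → ℝ} {u v w : ι} {h : ℝ} (hu : y u ≠ h)
    (hv : y v ≠ y u) (hw : y w ≠ y u) (heq : cut x y v u h = cut x y w u h) :
    cross x y u v w = 0 := by
  rw [cut, cut, div_eq_div_iff (sub_ne_zero.mpr hv) (sub_ne_zero.mpr hw)] at heq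
  refine (mul_eq_zero.mp ?_).resolve_left (sub_ne_zero.mpr hu.symm)
  unfold cross
  linear_combination heq

theorem isClosed_setOf_reach_Iic [Finite ι] (x y : ι → ℝ) (k : ℕ) (h : ℝ) :
    IsClosed {a | Reach x y k h (Set.Iic a)} := by
  simp only [Reach, Set.ofPred_exists, Set.ofPred_and, Set.ofPred_forall]
  refine isClosed_iUnion_of_finite fun M => isClosed_iUnion_of_finite fun W => ?_
  refine isClosed_const.inter (isClosed_const.inter (IsClosed.inter ?_ ?_))
  · exact isClosed_iInter fun w => isClosed_iInter fun _ => isClosed_const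
  exact isClosed_iInter fun v => isClosed_iInter fun _ => isClosed_iInter fun w =>
    isClosed_iInter fun _ => isClosed_iInter fun _ => isClosed_Ici

theorem isClosed_setOf_reach_Ici [Finite ι] (x y : ι → ℝ) (k : ℕ) (h : ℝ) :
    IsClosed {a | Reach x y k h (Set.Ici a)} := by
  simp only [Reach, Set.ofPred_exists, Set.ofPred_and, Set.ofPred_forall]
  refine isClosed_iUnion_of_finite fun M => isClosed_iUnion_of_finite fun W => ?_
  refine isClosed_const.inter (isClosed_const.inter (IsClosed.inter ?_ ?_))
  · exact isClosed_iInter fun w => isClosed_iInter fun _ => isClosed_const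
  exact isClosed_iInter fun v => isClosed_iInter fun _ => isClosed_iInter fun w =>
    isClosed_iInter fun _ => isClosed_iInter fun _ => isClosed_Iic

theorem isClosed_setOf_isTwisted [Finite ι] (x y : ι → ℝ) (k : ℕ) :
    IsClosed {h | IsTwisted x y k h} := by
  simp only [IsTwisted, Set.ofPred_exists, Set.ofPred_and, Set.ofPred_forall]
  refine isClosed_iUnion_of_finite fun M => isClosed_iUnion_of_finite fun W =>
    isClosed_iUnion_of_finite fun M' => isClosed_iUnion_of_finite fun W' => ?_
  refine isClosed_const.inter (isClosed_const.inter (isClosed_const.inter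
    (isClosed_const.inter (IsClosed.inter ?_ (IsClosed.inter ?_ ?_)))))
  · exact isClosed_iInter fun w => isClosed_iInter fun _ => isClosed_Ici
  · exact isClosed_iInter fun w => isClosed_iInter fun _ => isClosed_Ici
  · refine isClosed_iInter fun v => isClosed_iInter fun _ => isClosed_iInter fun w =>
      isClosed_iInter fun _ => isClosed_iInter fun v' => isClosed_iInter fun _ =>
      isClosed_iInter fun w' => isClosed_iInter fun _ => ?_
    have : {h | h < y v → h < y v' → cut x y v w h ≤ cut x y v' w' h} =
        Set.Ici (y v) ∪ (Set.Ici (y v') ∪ {h | cut x y v w h ≤ cut x y v' w' h}) := by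
      ext h
      simp only [Set.mem_ofPred_eq, Set.mem_union, Set.mem_Ici, ← not_lt]
      tauto
    rw [this]
    exact isClosed_Ici.union (isClosed_Ici.union
      (isClosed_le (continuous_cut ..) (continuous_cut ..)))

theorem exists_isTwisted [Fintype ι] (x y : ι → ℝ) {k : ℕ} (hk : 0 < k)
    (hcard : Fintype.card ι = 3 * k) : ∃ h, IsTwisted x y k h := by
  obtain ⟨h, hh⟩ := (Set.finite_range y).bddAbove
  have hh' : ∀ i, y i ≤ h := fun i => hh ⟨i, rfl⟩
  refine ⟨h, ∅, Finset.univ, ∅, Finset.univ, by simpa, ?_, by simpa, ?_, fun w _ => hh' w,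
    fun w _ => hh' w, fun v _ w _ v' _ w' _ hv => absurd (hh' v) (not_le.mpr hv)⟩ <;>
  · rw [Finset.card_univ]
    omega

theorem cut_right_injective {x y : ι → ℝ}
    (hxy : ∀ i j l, i ≠ j → i ≠ l → j ≠ l → cross x y i j l ≠ 0) {u v w : ι} {h : ℝ}
    (hu : y u < h) (hv : h ≤ y v) (hw : h ≤ y w) (heq : cut x y v u h = cut x y w u h) :
    v = w := by
  by_contra hne
  have hvu : y v ≠ y u := (hu.trans_le hv).ne'
  have hwu : y w ≠ y u := (hu.trans_le hw).ne'
  exact hxy u v w (fun h => hvu (congrArg y h.symm)) (fun h => hwu (congrArg y h.symm)) hne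
    (cross_eq_zero_of_cut_eq hu.ne hvu hwu heq)

theorem cut_left_injective {x y : ι → ℝ}
    (hxy : ∀ i j l, i ≠ j → i ≠ l → j ≠ l → cross x y i j l ≠ 0) {u v w : ι} {h : ℝ}
    (hu : h < y u) (hv : y v ≤ h) (hw : y w ≤ h) (heq : cut x y u v h = cut x y u w h) :
    v = w := by
  by_contra hne
  have hvu : y v ≠ y u := (hv.trans_lt hu).ne
  have hwu : y w ≠ y u := (hw.trans_lt hu).ne
  rw [cut_comm, cut_comm x y u w] at heq
  exact hxy u v w (fun h => hvu (congrArg y h.symm)) (fun h => hwu (congrArg y h.symm)) hne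
    (cross_eq_zero_of_cut_eq hu.ne' hvu hwu heq)

theorem exists_two_mem_notMem {M Z : Finset ι} {k : ℕ} (hM : M.card < k) (hZ : k < Z.card) :
    ∃ u ∈ Z, u ∉ M ∧ ∃ v ∈ Z, v ∉ M ∧ u ≠ v := by
  classical
  have h1 := Finset.le_card_sdiff M Z
  obtain ⟨u, hu, v, hv, huv⟩ := Finset.one_lt_card.mp (show 1 < (Z \ M).card by omega)
  rw [Finset.mem_sdiff] at hu hv
  exact ⟨u, hu.1, hu.2, v, hv.1, hv.2, huv⟩

theorem exists_mem_notMem_ne {y : ι → ℝ} (hy : y.Injective) {M Z : Finset ι} {k : ℕ} {h : ℝ}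
    (hM : M.card < k) (hZ : k < Z.card) : ∃ u ∈ Z, u ∉ M ∧ y u ≠ h := by
  obtain ⟨u, hu, huM, v, hv, hvM, huv⟩ := exists_two_mem_notMem hM hZ
  by_cases h' : y u = h
  · exact ⟨v, hv, hvM, fun h'' => huv (hy (h'.trans h''.symm))⟩
  · exact ⟨u, hu, huM, h'⟩

theorem IsTwisted.not_neg [Fintype ι] {x y : ι → ℝ} {k : ℕ} {h : ℝ} (hy : y.Injective)
    (hxy : ∀ i j l, i ≠ j → i ≠ l → j ≠ l → cross x y i j l ≠ 0)
    (hgen : ∀ r v w v' w', y w < y r → y r < y v → y w' < y r → y r < y v' →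
      cut x y v w (y r) = cut x y v' w' (y r) → v = v' ∧ w = w')
    (hcard : Fintype.card ι = 3 * k) (ht : IsTwisted x y k h) : ¬ IsTwisted x (-y) k (-h) := by
  classical
  rintro ⟨N, Z, N', Z', hN, hZ, hN', hZ', hZh, hZh', hB⟩
  obtain ⟨M, W, M', W', hM, hW, hM', hW', hWh, hWh', hA⟩ := ht
  simp only [cut_neg, Pi.neg_apply, neg_le_neg_iff, neg_lt_neg_iff] at hB hZh hZh'
  replace hB : ∀ l ∉ N, ∀ z ∈ Z, ∀ l' ∉ N', ∀ z' ∈ Z', y l < h → y l' < h →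
      cut x y z l h ≤ cut x y z' l' h := fun l hl z hz l' hl' z' hz' h1 h2 => by
    rw [cut_comm x y z, cut_comm x y z']
    exact hB l hl z hz l' hl' z' hz' h1 h2
  have key : ∀ v ∈ Z', v ∉ M → y v ≠ h → ∀ v' ∈ Z, v' ∉ M' → y v' ≠ h →
      ∀ w ∈ W, w ∉ N' → y w ≠ h → ∀ w' ∈ W', w' ∉ N → y w' ≠ h →
      cut x y v w h = cut x y v' w' h := fun v hv hvM hvh v' hv' hvM' hvh' w hw hwN hwh w' hw'
      hwN' hwh' =>
    le_antisymm
      (hA v hvM w hw v' hvM' w' hw' ((hZh' v hv).lt_of_ne' hvh) ((hZh v' hv').lt_of_ne' hvh'))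
      (hB w' hwN' v' hv' w hwN v hv ((hWh' w' hw').lt_of_ne hwh') ((hWh w hw).lt_of_ne hwh))
  obtain ⟨v', hv', hvM', hvh'⟩ := exists_mem_notMem_ne (h := h) hy hM' hZ
  obtain ⟨w, hw, hwN, hwh⟩ := exists_mem_notMem_ne (h := h) hy hN' hW
  obtain ⟨w', hw', hwN', hwh'⟩ := exists_mem_notMem_ne (h := h) hy hN hW'
  by_cases hlev : ∃ r, y r = h
  · obtain ⟨r, rfl⟩ := hlev
    have : Nonempty ι := ⟨r⟩
    obtain ⟨v, hv, hvM, hvh⟩ := exists_mem_notMem_ne (h := y r) hy hM hZ'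
    have hvr := (hZh' v hv).lt_of_ne' hvh
    have hwr := (hWh w hw).lt_of_ne hwh
    obtain ⟨rfl, rfl⟩ := hgen r v w v' w' hwr hvr
      ((hWh' w' hw').lt_of_ne hwh') ((hZh v' hv').lt_of_ne' hvh')
      (key v hv hvM hvh v' hv' hvM' hvh' w hw hwN hwh w' hw' hwN' hwh')
    have hZ1 : (Z ∩ Z').card ≤ 1 := by
      refine Finset.card_le_one_iff_subset_singleton.mpr ⟨v, fun z hz => ?_⟩
      rw [Finset.mem_inter] at hz
      rw [Finset.mem_singleton]
      exact cut_right_injective hxy hwr (hZh z hz.1) hvr.le (le_antisymm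
        (hB w hwN' z hz.1 w hwN v hv hwr hwr) (hB w hwN' v hv' w hwN z hz.2 hwr hwr))
    have hW1 : (W ∩ W').card ≤ 1 := by
      refine Finset.card_le_one_iff_subset_singleton.mpr ⟨w, fun z hz => ?_⟩
      rw [Finset.mem_inter] at hz
      rw [Finset.mem_singleton]
      exact cut_left_injective hxy hvr (hWh z hz.1) hwr.le (le_antisymm
        (hA v hvM z hz.1 v hvM' w hw' hvr hvr) (hA v hvM w hw v hvM' z hz.2 hvr hvr))
    have hr : ((Z ∪ Z') ∩ (W ∪ W')).card ≤ 1 := by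
      refine Finset.card_le_one_iff_subset_singleton.mpr ⟨r, fun z hz => ?_⟩
      simp only [Finset.mem_inter, Finset.mem_union] at hz
      rw [Finset.mem_singleton]
      exact hy (le_antisymm (hz.2.elim (hWh z) (hWh' z)) (hz.1.elim (hZh z) (hZh' z)))
    have h1 := Finset.card_union_add_card_inter Z Z'
    have h2 := Finset.card_union_add_card_inter W W'
    have h3 := Finset.card_union_add_card_inter (Z ∪ Z') (W ∪ W')
    have h4 := Finset.card_le_univ ((Z ∪ Z') ∪ (W ∪ W'))
    omega
  · push Not at hlev
    obtain ⟨u, hu, huM, v, hv, hvM, huv⟩ := exists_two_mem_notMem hM hZ'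
    refine huv (cut_right_injective hxy ((hWh w hw).lt_of_ne hwh) (hZh' u hu) (hZh' v hv) ?_)
    rw [key u hu huM (hlev u) v' hv' hvM' hvh' w hw hwN hwh w' hw' hwN' hwh',
      key v hv hvM (hlev v) v' hv' hvM' hvh' w hw hwN hwh w' hw' hwN' hwh']

theorem Reach.isTwisted {x y : ι → ℝ} {k : ℕ} {h a : ℝ} (h₁ : Reach x y k h (Set.Iic a))
    (h₂ : Reach x y k h (Set.Ici a)) : IsTwisted x y k h := by
  obtain ⟨M, W, hM, hW, hWh, hA⟩ := h₁
  obtain ⟨M', W', hM', hW', hWh', hA'⟩ := h₂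
  exact ⟨M, W, M', W', hM, hW, hM', hW', hWh, hWh', fun v hv w hw v' hv' w' hw' h₁ h₂ =>
    (hA v hv w hw h₁).trans (hA' v' hv' w' hw' h₂)⟩

theorem Reach.false_of_neg {x y : ι → ℝ} {k : ℕ} {h a : ℝ}
    (hxy : ∀ i j l, i ≠ j → i ≠ l → j ≠ l → cross x y i j l ≠ 0) (hh : ∀ i, y i ≠ h)
    {S S' : Set ℝ} (hS : ∀ c ∈ S, c ∈ S' → c = a) (h₁ : Reach x y k h S)
    (h₂ : Reach x (-y) k (-h) S') : False := by
  obtain ⟨M, W, hM, hW, hWh, hA⟩ := h₁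
  obtain ⟨N, Z, hN, hZ, hZh, hB⟩ := h₂
  simp only [cut_neg, Pi.neg_apply, neg_le_neg_iff, neg_lt_neg_iff] at hB hZh
  obtain ⟨u, hu, huM, v, hv, hvM, huv⟩ := exists_two_mem_notMem hM hZ
  obtain ⟨w, hw, hwN, -⟩ := exists_two_mem_notMem hN hW
  have hwh := (hWh w hw).lt_of_ne (hh w)
  have key : ∀ z ∈ Z, z ∉ M → cut x y z w h = a := fun z hz hzM =>
    hS _ (hA z hzM w hw ((hZh z hz).lt_of_ne' (hh z)))
      (by rw [cut_comm]; exact hB w hwN z hz hwh)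
  exact huv (cut_right_injective hxy hwh (hZh u hu) (hZh v hv)
    ((key u hu huM).trans (key v hv hvM).symm))

theorem exists_reach [Fintype ι] (x y : ι → ℝ) {k : ℕ} (hk : 0 < k)
    (hcard : Fintype.card ι = 3 * k) (h : ℝ) {S : Set ℝ} (hS : ∀ i j, cut x y i j h ∈ S) :
    Reach x y k h S ∨ Reach x (-y) k (-h) S := by
  have hsum := Finset.card_filter_add_card_filter_not (s := (Finset.univ : Finset ι)) (y · ≤ h)
  rw [Finset.card_univ, hcard] at hsum
  by_cases hlow : k < (Finset.univ.filter (y · ≤ h)).card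
  · exact Or.inl ⟨∅, Finset.univ.filter (y · ≤ h), by simpa, hlow, by simp,
      fun v _ w _ _ => hS v w⟩
  · refine Or.inr ⟨∅, Finset.univ.filter (¬ y · ≤ h), by simpa, by omega, ?_, fun v _ w _ _ => ?_⟩
    · simpa using fun w hw => le_of_lt hw
    · rw [cut_neg]
      exact hS v w

theorem exists_notMem_of_isClosed {A B F : Set ℝ} (hA : IsClosed A) (hB : IsClosed B)
    (hA' : A.Nonempty) (hB' : B.Nonempty) (hAB : Disjoint A B) (hF : F.Finite) :
    ∃ a, a ∉ F ∧ a ∉ A ∧ a ∉ B := by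
  by_contra! hcov
  have hsub : Fᶜ ⊆ A ∪ B := fun a ha => by
    by_cases haA : a ∈ A
    · exact Or.inl haA
    · exact Or.inr (hcov a ha haA)
  have huniv : (Set.univ : Set ℝ) ⊆ A ∪ B := by
    rw [← (hF.countable.dense_compl ℝ).closure_eq]
    exact closure_minimal hsub (hA.union hB)
  obtain ⟨a, -, ha⟩ := isPreconnected_closed_iff.mp isPreconnected_univ A B hA hB huniv
    (by simpa) (by simpa)
  exact Set.disjoint_iff.mp hAB ha

theorem exists_threshold (S : Finset ℝ) (b : ℝ) (hb : ∀ s ∈ S, s < b) (j : ℕ) (hj : j ≤ S.card) :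
    ∃ α < b, α ∉ S ∧ (S.filter (· < α)).card = j := by
  induction S using Finset.induction_on_max generalizing b with
  | empty =>
    obtain ⟨α, hα⟩ := exists_lt b
    exact ⟨α, hα, by simp, by simpa [eq_comm] using hj⟩
  | insert a S ha ih =>
    have haS : a ∉ S := fun h => lt_irrefl a (ha a h)
    have hab : a < b := hb a (Finset.mem_insert_self a S)
    rw [Finset.card_insert_of_notMem haS] at hj
    rcases Nat.lt_or_ge S.card j with hlt | hle
    · obtain ⟨α, h1, h2⟩ := exists_between hab
      have hlt' : ∀ s ∈ insert a S, s < α := fun s hs => by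
        rcases Finset.mem_insert.mp hs with rfl | hs
        exacts [h1, (ha s hs).trans h1]
      refine ⟨α, h2, fun h => lt_irrefl α (hlt' α h), ?_⟩
      rw [Finset.filter_true_of_mem hlt', Finset.card_insert_of_notMem haS]
      omega
    · obtain ⟨α, h1, h2, h3⟩ := ih a ha hle
      refine ⟨α, h1.trans hab, by simp [h1.ne, h2], ?_⟩
      rwa [Finset.filter_insert, if_neg (not_lt.mpr h1.le)]

theorem exists_threshold_of_injective [Fintype ι] {κ : ι → ℝ} (hκ : κ.Injective) {j : ℕ}
    (hj : j ≤ Fintype.card ι) :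
    ∃ α, (∀ i, κ i ≠ α) ∧ (Finset.univ.filter (κ · < α)).card = j := by
  classical
  obtain ⟨b, hb⟩ := (Set.finite_range κ).bddAbove
  obtain ⟨α, -, h1, h2⟩ := exists_threshold (Finset.univ.image κ) (b + 1)
    (by simpa using fun i => lt_add_of_le_of_pos (hb ⟨i, rfl⟩) one_pos) j
    (by rwa [Finset.card_image_of_injective _ hκ])
  refine ⟨α, by simpa using h1, ?_⟩
  rwa [Finset.filter_image, Finset.card_image_of_injective _ hκ] at h2

theorem card_filter_of_not_reach [Fintype ι] {x y : ι → ℝ} {k : ℕ} {h : ℝ} (hh : ∀ i, y i ≠ h)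
    (p : ι → Prop) [DecidablePred p]
    (hp : (Finset.univ.filter p).card = 2 * k) {S S' : Set ℝ}
    (hS : ∀ v w, y w < h → h < y v → ¬ p v → p w → cut x y v w h ∈ S)
    (hS' : ∀ v w, y w < h → h < y v → p v → ¬ p w → cut x y v w h ∈ S')
    (h₁ : ¬ Reach x y k h S) (h₂ : ¬ Reach x (-y) k (-h) S') :
    (Finset.univ.filter fun i => h < y i ∧ ¬ p i).card + k =
      (Finset.univ.filter fun i => h < y i).card := by
  have hU : (Finset.univ.filter fun i => h < y i).card =
      (Finset.univ.filter fun i => h < y i ∧ ¬ p i).card +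
      (Finset.univ.filter fun i => h < y i ∧ p i).card := by
    simp only [Finset.card_filter, ← Finset.sum_add_distrib]
    refine Finset.sum_congr rfl fun i _ => ?_
    by_cases h < y i <;> by_cases p i <;> simp [*]
  have hp' : (Finset.univ.filter p).card = (Finset.univ.filter fun i => h < y i ∧ p i).card +
      (Finset.univ.filter fun i => ¬ h < y i ∧ p i).card := by
    simp only [Finset.card_filter, ← Finset.sum_add_distrib]
    refine Finset.sum_congr rfl fun i _ => ?_
    by_cases h < y i <;> by_cases p i <;> simp [*]
  have hlt : ∀ i, ¬ h < y i → y i < h := fun i hi => (not_lt.mp hi).lt_of_ne (hh i)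
  rcases lt_trichotomy ((Finset.univ.filter fun i => h < y i ∧ ¬ p i).card + k)
    (Finset.univ.filter fun i => h < y i).card with hlt' | heq | hgt
  · refine absurd ⟨Finset.univ.filter fun i => ¬ h < y i ∧ p i,
      Finset.univ.filter fun i => h < y i ∧ p i, by omega, by omega, ?_, ?_⟩ h₂
    · intro w hw
      simpa using (Finset.mem_filter.mp hw).2.1.le
    · intro v hv w hw hvh
      have hvh' : y v < h := by simpa using hvh
      have hw' := (Finset.mem_filter.mp hw).2
      rw [cut_neg, cut_comm]
      exact hS' w v hvh' hw'.1 hw'.2 fun hpv => hv (by simp [hpv, hvh'.le])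
  · exact heq
  · refine absurd ⟨Finset.univ.filter fun i => h < y i ∧ p i,
      Finset.univ.filter fun i => ¬ h < y i ∧ p i, by omega, by omega, ?_, ?_⟩ h₁
    · intro w hw
      exact not_lt.mp (Finset.mem_filter.mp hw).2.1
    · intro v hv w hw hvh
      have hw' := (Finset.mem_filter.mp hw).2
      exact hS v w (hlt w hw'.1) hvh (fun hpv => hv (by simp [hpv, hvh])) hw'.2

theorem exists_pencil_of_not_isTwisted [Fintype ι] {x y : ι → ℝ} {k : ℕ} {h : ℝ}
    (hk : 0 < k) (hcard : Fintype.card ι = 3 * k) (hy : y.Injective)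
    (hxy : ∀ i j l, i ≠ j → i ≠ l → j ≠ l → cross x y i j l ≠ 0) (hh : ∀ i, y i ≠ h)
    (h₁ : ¬ IsTwisted x y k h) (h₂ : ¬ IsTwisted x (-y) k (-h)) :
    ∃ a α β : ℝ, α < β ∧ (∀ i, (x i - a) / (y i - h) ≠ α) ∧ (∀ i, (x i - a) / (y i - h) ≠ β) ∧
      (Finset.univ.filter fun i => (x i - a) / (y i - h) < α).card = k ∧
      (Finset.univ.filter fun i => (x i - a) / (y i - h) < β).card = 2 * k ∧
      (Finset.univ.filter fun i => h < y i ∧ (x i - a) / (y i - h) < α).card + k =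
        (Finset.univ.filter fun i => h < y i).card ∧
      (Finset.univ.filter fun i => h < y i ∧ ¬ (x i - a) / (y i - h) < β).card + k =
        (Finset.univ.filter fun i => h < y i).card := by
  have hF : (Set.range fun ij : ι × ι => cut x y ij.1 ij.2 h).Finite := Set.finite_range _
  obtain ⟨a₁, ha₁⟩ := hF.bddAbove
  obtain ⟨a₂, ha₂⟩ := hF.bddBelow
  obtain ⟨a, haF, hUp, hDown⟩ := exists_notMem_of_isClosed
    (A := {a | Reach x y k h (Set.Iic a)} ∪ {a | Reach x (-y) k (-h) (Set.Iic a)})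
    (B := {a | Reach x y k h (Set.Ici a)} ∪ {a | Reach x (-y) k (-h) (Set.Ici a)})
    ((isClosed_setOf_reach_Iic ..).union (isClosed_setOf_reach_Iic ..))
    ((isClosed_setOf_reach_Ici ..).union (isClosed_setOf_reach_Ici ..))
    ⟨a₁, exists_reach x y hk hcard h fun i j => ha₁ ⟨(i, j), rfl⟩⟩
    ⟨a₂, exists_reach x y hk hcard h fun i j => ha₂ ⟨(i, j), rfl⟩⟩
    (by
      rw [Set.disjoint_left]
      rintro a (h1 | h1) (h2 | h2)
      · exact h₁ (Reach.isTwisted h1 h2)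
      · exact Reach.false_of_neg hxy hh (fun c h h' => le_antisymm h h') h1 h2
      · exact Reach.false_of_neg hxy hh (fun c h h' => le_antisymm h' h) h2 h1
      · exact h₂ (Reach.isTwisted h1 h2)) hF
  simp only [Set.mem_union, Set.mem_ofPred_eq, not_or] at hUp hDown
  set κ : ι → ℝ := fun i => (x i - a) / (y i - h) with hκ
  have hκinj : κ.Injective := fun i j hij => by
    by_contra hne
    exact haF ⟨(i, j), cut_eq_of_div_eq (hy.ne hne) (hh i) (hh j) hij⟩
  obtain ⟨α, hα, hαc⟩ := exists_threshold_of_injective hκinj (j := k) (by omega)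
  obtain ⟨β, hβ, hβc⟩ := exists_threshold_of_injective hκinj (j := 2 * k) (by omega)
  have hαβ : α < β := by
    by_contra! hle
    have := Finset.card_le_card (Finset.monotone_filter_right Finset.univ
      fun i _ (hi : κ i < β) => hi.trans_le hle)
    omega
  have hnot : ∀ i, ¬ α < κ i ↔ κ i < α := fun i =>
    not_lt.trans (le_iff_lt_or_eq.trans (or_iff_left (hα i)))
  have hα' : (Finset.univ.filter (α < κ ·)).card = 2 * k := by
    have := Finset.card_filter_add_card_filter_not (s := (Finset.univ : Finset ι)) (α < κ ·)
    simp only [hnot] at this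
    rw [Finset.card_univ, hcard, hαc] at this
    omega
  have hu₁ := card_filter_of_not_reach (k := k) hh (α < κ ·) hα' (S := Set.Iic a) (S' := Set.Ici a)
    (fun v w hw hv h1 h2 => (cut_le_iff hw hv a).mpr ((not_lt.mp h1).trans h2.le))
    (fun v w hw hv h1 h2 => (le_cut_iff hw hv a).mpr ((not_lt.mp h2).trans h1.le))
    hUp.1 hDown.2
  have hu₃ := card_filter_of_not_reach (k := k) hh (κ · < β) hβc (S := Set.Ici a) (S' := Set.Iic a)
    (fun v w hw hv h1 h2 => (le_cut_iff hw hv a).mpr (h2.le.trans (not_lt.mp h1)))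
    (fun v w hw hv h1 h2 => (cut_le_iff hw hv a).mpr (h1.le.trans (not_lt.mp h2)))
    hDown.1 hUp.2
  simp only [hnot] at hu₁
  exact ⟨a, α, β, hαβ, hα, hβ, hαc, hβc, hu₁, hu₃⟩

theorem forall_pos_iff_eq {g : Fin 3 → ℝ} :
    ((∀ j, 0 < g j ↔ j = 0) ↔ 0 < g 0 ∧ ¬ 0 < g 1 ∧ ¬ 0 < g 2) ∧
    ((∀ j, 0 < g j ↔ j = 1) ↔ ¬ 0 < g 0 ∧ 0 < g 1 ∧ ¬ 0 < g 2) ∧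
    ((∀ j, 0 < g j ↔ j = 2) ↔ ¬ 0 < g 0 ∧ ¬ 0 < g 1 ∧ 0 < g 2) := by
  refine ⟨?_, ?_, ?_⟩ <;> simp [Fin.forall_fin_succ]

theorem forall_neg_iff_eq {g : Fin 3 → ℝ} (hg : ∀ j, g j ≠ 0) :
    ((∀ j, g j < 0 ↔ j = 0) ↔ ¬ 0 < g 0 ∧ 0 < g 1 ∧ 0 < g 2) ∧
    ((∀ j, g j < 0 ↔ j = 1) ↔ 0 < g 0 ∧ ¬ 0 < g 1 ∧ 0 < g 2) ∧
    ((∀ j, g j < 0 ↔ j = 2) ↔ 0 < g 0 ∧ 0 < g 1 ∧ ¬ 0 < g 2) := by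
  have hneg : ∀ j, g j < 0 ↔ ¬ 0 < g j := fun j =>
    ⟨fun h => h.not_gt, fun h' => (not_lt.mp h').lt_of_ne (hg j)⟩
  simp only [hneg]
  refine ⟨?_, ?_, ?_⟩ <;> simp [Fin.forall_fin_succ]

theorem mul_pos_iff_pos_iff_pos {c v : ℝ} (hc : c ≠ 0) (hv : v ≠ 0) :
    0 < c * v ↔ (0 < c ↔ 0 < v) := by
  rcases hc.lt_or_gt with h | h <;> rcases hv.lt_or_gt with h' | h' <;>
    simp [mul_pos_iff, h, h', h.not_gt, h'.not_gt]

theorem pencil_sextant_iff {α β u v : ℝ} (hαβ : α < β) (hv : v ≠ 0) (hα : u / v ≠ α)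
    (hβ : u / v ≠ β) {g : Fin 3 → ℝ}
    (hg : ∀ j, (![0, -1, 1] : Fin 3 → ℝ) j * u + (![β - α, α, -β] : Fin 3 → ℝ) j * v = g j) :
    (∀ j, g j ≠ 0) ∧
    ((∀ j, 0 < g j ↔ j = 0) ↔ 0 < v ∧ ¬ u / v < α ∧ u / v < β) ∧
    ((∀ j, 0 < g j ↔ j = 1) ↔ ¬ 0 < v ∧ ¬ u / v < β) ∧
    ((∀ j, 0 < g j ↔ j = 2) ↔ ¬ 0 < v ∧ u / v < α) ∧
    ((∀ j, g j < 0 ↔ j = 0) ↔ ¬ 0 < v ∧ ¬ u / v < α ∧ u / v < β) ∧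
    ((∀ j, g j < 0 ↔ j = 1) ↔ 0 < v ∧ ¬ u / v < β) ∧
    ((∀ j, g j < 0 ↔ j = 2) ↔ 0 < v ∧ u / v < α) := by
  have h1 : u = u / v * v := (div_mul_cancel₀ u hv).symm
  generalize u / v = κ at *
  subst h1
  have g0 : (β - α) * v = g 0 := by rw [← hg]; simp
  have g1 : (α - κ) * v = g 1 := by rw [← hg]; simp; ring
  have g2 : (κ - β) * v = g 2 := by rw [← hg]; simp; ring
  have hne : ∀ j, g j ≠ 0 := by
    rw [Fin.forall_fin_succ, Fin.forall_fin_two, Fin.succ_zero_eq_one, Fin.succ_one_eq_two,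
      ← g0, ← g1, ← g2]
    exact ⟨mul_ne_zero (sub_pos.mpr hαβ).ne' hv, mul_ne_zero (sub_ne_zero.mpr hα.symm) hv,
      mul_ne_zero (sub_ne_zero.mpr hβ) hv⟩
  have p0 : 0 < g 0 ↔ 0 < v := by rw [← g0, mul_pos_iff_of_pos_left (sub_pos.mpr hαβ)]
  have p1 : 0 < g 1 ↔ (κ < α ↔ 0 < v) := by
    rw [← g1, mul_pos_iff_pos_iff_pos (sub_ne_zero.mpr hα.symm) hv, sub_pos]
  have p2 : 0 < g 2 ↔ (¬ κ < β ↔ 0 < v) := by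
    rw [← g2, mul_pos_iff_pos_iff_pos (sub_ne_zero.mpr hβ) hv, sub_pos, not_lt,
      hβ.symm.le_iff_lt]
  obtain ⟨e0, e1, e2⟩ := forall_pos_iff_eq (g := g)
  obtain ⟨f0, f1, f2⟩ := forall_neg_iff_eq hne
  have hκ : κ < α → κ < β := fun h => h.trans hαβ
  rw [e0, e1, e2, f0, f1, f2, p0, p1, p2]
  refine ⟨hne, ?_⟩
  clear * - hκ
  by_cases 0 < v <;> by_cases κ < α <;> by_cases κ < β <;> simp_all only [not_true_eq_false,
    not_false_eq_true, iff_true, iff_false, true_imp_iff, and_true, and_false, and_self]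

theorem card_sextants [Fintype ι] {U p q : ι → Prop} [DecidablePred U] [DecidablePred p]
    [DecidablePred q] {k : ℕ} (hcard : Fintype.card ι = 3 * k) (hpq : ∀ i, p i → q i)
    (hp : (Finset.univ.filter p).card = k) (hq : (Finset.univ.filter q).card = 2 * k)
    (hUp : (Finset.univ.filter fun i => U i ∧ p i).card + k = (Finset.univ.filter U).card)
    (hUq : (Finset.univ.filter fun i => U i ∧ ¬ q i).card + k = (Finset.univ.filter U).card) :
    (Finset.univ.filter fun i => U i ∧ ¬ p i ∧ q i).card =
      k - (Finset.univ.filter fun i => U i ∧ p i).card ∧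
    (Finset.univ.filter fun i => ¬ U i ∧ ¬ q i).card =
      k - (Finset.univ.filter fun i => U i ∧ p i).card ∧
    (Finset.univ.filter fun i => ¬ U i ∧ p i).card =
      k - (Finset.univ.filter fun i => U i ∧ p i).card ∧
    (Finset.univ.filter fun i => ¬ U i ∧ ¬ p i ∧ q i).card =
      (Finset.univ.filter fun i => U i ∧ p i).card := by
  have h1 : (Finset.univ.filter U).card = (Finset.univ.filter fun i => U i ∧ p i).card +
      (Finset.univ.filter fun i => U i ∧ ¬ q i).card +
      (Finset.univ.filter fun i => U i ∧ ¬ p i ∧ q i).card := by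
    simp only [Finset.card_filter, ← Finset.sum_add_distrib]
    refine Finset.sum_congr rfl fun i _ => ?_
    have := hpq i
    by_cases U i <;> by_cases p i <;> by_cases q i <;> simp_all
  have h2 : (Finset.univ.filter p).card = (Finset.univ.filter fun i => U i ∧ p i).card +
      (Finset.univ.filter fun i => ¬ U i ∧ p i).card := by
    simp only [Finset.card_filter, ← Finset.sum_add_distrib]
    refine Finset.sum_congr rfl fun i _ => ?_
    by_cases U i <;> by_cases p i <;> simp [*]
  have h3 : (Finset.univ.filter q).card = (Finset.univ.filter p).card +
      (Finset.univ.filter fun i => U i ∧ ¬ p i ∧ q i).card +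
      (Finset.univ.filter fun i => ¬ U i ∧ ¬ p i ∧ q i).card := by
    simp only [Finset.card_filter, ← Finset.sum_add_distrib]
    refine Finset.sum_congr rfl fun i _ => ?_
    have := hpq i
    by_cases U i <;> by_cases p i <;> by_cases q i <;> simp_all
  have h4 : Fintype.card ι = (Finset.univ.filter q).card +
      (Finset.univ.filter fun i => U i ∧ ¬ q i).card +
      (Finset.univ.filter fun i => ¬ U i ∧ ¬ q i).card := by
    rw [← Finset.card_univ, Finset.card_eq_sum_ones]
    simp only [Finset.card_filter, ← Finset.sum_add_distrib]
    refine Finset.sum_congr rfl fun i _ => ?_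
    by_cases U i <;> by_cases q i <;> simp [*]
  omega

/-- Coefficients of three concurrent lines which cut the configuration `(x, y)` into sextants of
alternating sizes. -/
theorem exists_sextant_partition_of_not_isTwisted [Fintype ι] {x y : ι → ℝ} {k : ℕ} {h : ℝ}
    (hk : 0 < k) (hcard : Fintype.card ι = 3 * k) (hy : y.Injective)
    (hxy : ∀ i j l, i ≠ j → i ≠ l → j ≠ l → cross x y i j l ≠ 0) (hh : ∀ i, y i ≠ h)
    (h₁ : ¬ IsTwisted x y k h) (h₂ : ¬ IsTwisted x (-y) k (-h)) :
    ∃ (A B : Fin 3 → ℝ) (a : ℝ) (s t : ℕ), ∑ j, A j = 0 ∧ ∑ j, B j = 0 ∧ s + t = k ∧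
      (∀ j i, A j * (x i - a) + B j * (y i - h) ≠ 0) ∧
      (∀ m, (Finset.univ.filter fun i =>
        ∀ j, 0 < A j * (x i - a) + B j * (y i - h) ↔ j = m).card = s) ∧
      ∀ m, (Finset.univ.filter fun i =>
        ∀ j, A j * (x i - a) + B j * (y i - h) < 0 ↔ j = m).card = t := by
  obtain ⟨a, α, β, hαβ, hα, hβ, hαc, hβc, hu₁, hu₃⟩ :=
    exists_pencil_of_not_isTwisted hk hcard hy hxy hh h₁ h₂
  have hsign := fun i => pencil_sextant_iff hαβ (sub_ne_zero.mpr (hh i)) (hα i) (hβ i)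
    fun j => rfl
  simp only [sub_pos (b := h)] at hsign
  obtain ⟨S0, S1, S2, T0⟩ := card_sextants hcard (fun i hi => hi.trans hαβ) hαc hβc hu₁ hu₃
  refine ⟨![0, -1, 1], ![β - α, α, -β], a,
    k - (Finset.univ.filter fun i => h < y i ∧ (x i - a) / (y i - h) < α).card,
    (Finset.univ.filter fun i => h < y i ∧ (x i - a) / (y i - h) < α).card,
    by simp [Fin.sum_univ_three], by simp [Fin.sum_univ_three], ?_, fun j i => (hsign i).1 j,
    ?_, ?_⟩
  · have := Finset.card_le_card (Finset.monotone_filter_right Finset.univ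
      fun i _ (hi : h < y i ∧ (x i - a) / (y i - h) < α) => hi.2)
    omega
  · rw [Fin.forall_fin_succ, Fin.forall_fin_two]
    simp only [Fin.succ_zero_eq_one, Fin.succ_one_eq_two, hsign]
    exact ⟨S0, S1, S2⟩
  · rw [Fin.forall_fin_succ, Fin.forall_fin_two]
    simp only [Fin.succ_zero_eq_one, Fin.succ_one_eq_two, hsign]
    exact ⟨T0, by omega, trivial⟩

/-- A configuration of `3 * k` points in general position is cut into sextants of alternating sizes
`s` and `t`, where `s + t = k`, by three concurrent lines one of which is horizontal. -/
theorem exists_sextant_partition [Fintype ι] {x y : ι → ℝ} {k : ℕ} (hk : 0 < k)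
    (hcard : Fintype.card ι = 3 * k) (hy : y.Injective)
    (hxy : ∀ i j l, i ≠ j → i ≠ l → j ≠ l → cross x y i j l ≠ 0)
    (hgen : ∀ r v w v' w', y w < y r → y r < y v → y w' < y r → y r < y v' →
      cut x y v w (y r) = cut x y v' w' (y r) → v = v' ∧ w = w') :
    ∃ (A B : Fin 3 → ℝ) (a h : ℝ) (s t : ℕ), ∑ j, A j = 0 ∧ ∑ j, B j = 0 ∧ s + t = k ∧
      (∀ j i, A j * (x i - a) + B j * (y i - h) ≠ 0) ∧
      (∀ m, (Finset.univ.filter fun i =>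
        ∀ j, 0 < A j * (x i - a) + B j * (y i - h) ↔ j = m).card = s) ∧
      ∀ m, (Finset.univ.filter fun i =>
        ∀ j, A j * (x i - a) + B j * (y i - h) < 0 ↔ j = m).card = t := by
  obtain ⟨h', hh'⟩ := exists_isTwisted x (-y) hk hcard
  obtain ⟨h, hF, h₁, h₂⟩ := exists_notMem_of_isClosed (isClosed_setOf_isTwisted x y k)
    ((isClosed_setOf_isTwisted x (-y) k).preimage continuous_neg) (exists_isTwisted x y hk hcard)
    ⟨-h', by simpa using hh'⟩
    (Set.disjoint_left.mpr fun _ ht => ht.not_neg hy hxy hgen hcard) (Set.finite_range y)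
  obtain ⟨A, B, a, s, t, H⟩ := exists_sextant_partition_of_not_isTwisted hk hcard hy hxy
    (fun i hi => hF ⟨i, hi⟩) h₁ h₂
  exact ⟨A, B, a, h, s, t, H⟩

theorem exists_injOn_add_mul {Ω : Set (ℝ × ℝ)} (hΩ : Ω.Finite) :
    ∃ c : ℝ, Set.InjOn (fun p : ℝ × ℝ => p.2 + c * p.1) Ω := by
  obtain ⟨c, hc⟩ := ((hΩ.prod hΩ).image fun pq : (ℝ × ℝ) × (ℝ × ℝ) =>
    (pq.2.2 - pq.1.2) / (pq.1.1 - pq.2.1)).exists_notMem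
  refine ⟨c, fun p hp q hq hpq => ?_⟩
  have hpq : p.2 + c * p.1 = q.2 + c * q.1 := hpq
  have h : p.1 = q.1 := by
    by_contra hne
    refine hc ⟨(p, q), ⟨hp, hq⟩, ?_⟩
    rw [div_eq_iff (sub_ne_zero.mpr hne)]
    linarith
  exact Prod.ext h (by rw [h] at hpq; linarith)

theorem cross_add_mul (x z : ι → ℝ) (c : ℝ) (i j l : ι) :
    cross x (fun i => z i + c * x i) i j l = cross x z i j l := by
  unfold cross
  ring

theorem cut_eq_add_mul {x y : ι → ℝ} {v w : ι} (h : ℝ) (hvw : y v ≠ y w) :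
    cut x y v w h = x w + (h - y w) / (y v - y w) * (x v - x w) := by
  have : y v - y w ≠ 0 := sub_ne_zero.mpr hvw
  unfold cut
  field_simp
  ring

/-- After a generic shear, no two lines spanned by a configuration in general position cross at
the height of a point of the configuration. -/
theorem exists_generic_shear [Finite ι] {x z : ι → ℝ}
    (hinj : Function.Injective fun i => (x i, z i))
    (hxz : ∀ i j l, i ≠ j → i ≠ l → j ≠ l → cross x z i j l ≠ 0) :
    ∃ (c : ℝ) (y : ι → ℝ), (∀ i, y i = z i + c * x i) ∧ y.Injective ∧
      ∀ r v w v' w', y w < y r → y r < y v → y w' < y r → y r < y v' →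
        cut x y v w (y r) = cut x y v' w' (y r) → v = v' ∧ w = w' := by
  set τ : ι × ι × ι × ι → ℝ := fun q =>
    ((x q.2.2.2 - x q.2.1) * (z q.2.2.1 - z q.2.2.2) -
      (z q.2.2.2 - z q.2.1) * (x q.2.2.1 - x q.2.2.2)) /
    ((x q.1 - x q.2.1) * (z q.2.2.1 - z q.2.2.2) -
      (z q.1 - z q.2.1) * (x q.2.2.1 - x q.2.2.2)) with hτ
  set Q : ι × ι × ι × ι → ℝ × ℝ := fun q =>
    (x q.2.1 + τ q * (x q.1 - x q.2.1), z q.2.1 + τ q * (z q.1 - z q.2.1)) with hQ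
  obtain ⟨c, hc⟩ := exists_injOn_add_mul
    ((Set.finite_range fun i => (x i, z i)).union (Set.finite_range Q))
  refine ⟨c, fun i => z i + c * x i, fun _ => rfl, fun i j hij => hinj
    (hc (Or.inl ⟨i, rfl⟩) (Or.inl ⟨j, rfl⟩) hij), fun r v w v' w' hw hv hw' hv' heq => ?_⟩
  have hxy : ∀ i j l, i ≠ j → i ≠ l → j ≠ l → cross x (fun i => z i + c * x i) i j l ≠ 0 :=
    fun i j l => by rw [cross_add_mul]; exact hxz i j l
  rw [cut_eq_add_mul _ (hw.trans hv).ne', cut_eq_add_mul _ (hw'.trans hv').ne'] at heq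
  set y : ι → ℝ := fun i => z i + c * x i with hy
  have hd : y v - y w ≠ 0 := (sub_pos.mpr (hw.trans hv)).ne'
  have hd' : y v' - y w' ≠ 0 := (sub_pos.mpr (hw'.trans hv')).ne'
  have hσ : (y r - y w) / (y v - y w) * (y v - y w) = y r - y w := div_mul_cancel₀ _ hd
  have hσ' : (y r - y w') / (y v' - y w') * (y v' - y w') = y r - y w' := div_mul_cancel₀ _ hd'
  generalize (y r - y w) / (y v - y w) = σ at heq hσ
  generalize (y r - y w') / (y v' - y w') = σ' at heq hσ'
  by_cases hdet : (x v - x w) * (y v' - y w') - (y v - y w) * (x v' - x w') = 0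
  · have key : ∀ u, (x u - x w') * (y v' - y w') = (y u - y w') * (x v' - x w') → y u ≠ y r →
        u = v ∨ u = w := fun u hu hur => by
      by_contra! hne
      refine hxy u v w hne.1 hne.2 (fun h => hd (by rw [h, sub_self])) ?_
      refine (mul_eq_zero.mp ?_).resolve_left hd'
      unfold cross
      linear_combination (y v' - y w') * (x v - x w) * (hσ - hσ') -
        (y v' - y w') * (y v - y w) * heq + ((y v' - y w') * σ' + (y w' - y u)) * hdet +
        (y v - y w) * hu
    have h1 := key v' (by ring) hv'.ne'
    have h2 := key w' (by ring) hw'.ne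
    refine ⟨(h1.resolve_right ?_).symm, (h2.resolve_left ?_).symm⟩
    · rintro rfl
      exact (hw.trans hv').false
    · rintro rfl
      exact (hw'.trans hv).false
  · exfalso
    have hσQ : σ = τ (v, w, v', w') := by
      simp only [hy] at hdet hσ hσ'
      rw [hτ, eq_div_iff (fun h => hdet (by linear_combination h))]
      linear_combination (z v' - z w') * heq - (x v' - x w') * (hσ - hσ' - c * heq)
    have hr : (x r, z r) = Q (v, w, v', w') := by
      refine hc (Or.inl ⟨r, rfl⟩) (Or.inr ⟨_, rfl⟩) ?_
      simp only [hQ, ← hσQ]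
      simp only [hy] at hσ
      linarith
    simp only [hQ, ← hσQ, Prod.mk.injEq] at hr
    refine hxz r v w (fun h => ?_) (fun h => ?_) (fun h => hd (by rw [h, sub_self])) ?_
    · subst h; exact hv.false
    · subst h; exact hw.false
    · unfold cross
      rw [hr.1, hr.2]
      ring

end Configuration

/-- No three points of `P` are collinear. -/
def NoThreeCollinear (P : Finset Pt) : Prop :=
  ∀ p ∈ P, ∀ q ∈ P, ∀ s ∈ P, p ≠ q → p ≠ s → q ≠ s → cross (· 0) (· 1) p q s ≠ 0

theorem collinear_of_cross_eq_zero {p q s : Pt} (hpq : p ≠ q)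
    (h : cross (· 0) (· 1) p q s = 0) : Collinear ℝ ({p, q, s} : Set Pt) := by
  simp only [cross] at h
  rw [collinear_iff_of_mem (p₀ := p) (by simp)]
  have hs : ∃ r : ℝ, s = r • (q - p) +ᵥ p := by
    by_cases h0 : q 0 = p 0
    · have h1 : q 1 - p 1 ≠ 0 := fun h1 => hpq (ext_of_coords h0.symm (sub_eq_zero.mp h1).symm)
      refine ⟨(s 1 - p 1) / (q 1 - p 1), ext_of_coords ?_ ?_⟩
      · rw [h0, sub_self, zero_mul, zero_sub, neg_eq_zero] at h
        simpa [h0, sub_eq_zero] using (mul_eq_zero.mp h).resolve_right h1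
      · simp [h1]
    · have h1 : q 0 - p 0 ≠ 0 := sub_ne_zero.mpr h0
      refine ⟨(s 0 - p 0) / (q 0 - p 0), ext_of_coords ?_ ?_⟩
      · simp [h1]
      · simp
        field_simp
        linarith
  refine ⟨q - p, ?_⟩
  simp only [Set.mem_insert_iff, Set.mem_singleton_iff, forall_eq_or_imp, forall_eq]
  exact ⟨⟨0, by simp⟩, ⟨1, by simp⟩, hs⟩

theorem cross_rotate {ι : Type*} (x y : ι → ℝ) (i j l : ι) : cross x y i j l = cross x y j l i := by
  unfold cross
  ring

theorem NoThreeCollinear.exists_insert {P : Finset Pt} (hP : NoThreeCollinear P) :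
    ∃ z ∉ P, NoThreeCollinear (insert z P) := by
  obtain ⟨u, hu⟩ := (P.image (· 0)).exists_notMem
  obtain ⟨v, hv⟩ := ((P ×ˢ P).image fun pq : Pt × Pt =>
    pq.1 1 + (u - pq.1 0) * (pq.2 1 - pq.1 1) / (pq.2 0 - pq.1 0)).exists_notMem
  have hz : ∀ p ∈ P, ∀ q ∈ P, p ≠ q → cross (· 0) (· 1) p q !₂[u, v] ≠ 0 :=
      fun p hp q hq hpq h => by
    simp only [cross, Matrix.cons_val_zero, Matrix.cons_val_one] at h
    have hup : u - p 0 ≠ 0 := fun h => hu (by simpa using ⟨p, hp, (sub_eq_zero.mp h).symm⟩)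
    by_cases h0 : q 0 - p 0 = 0
    · rw [h0, zero_mul, zero_sub, neg_eq_zero] at h
      exact hpq (ext_of_coords (sub_eq_zero.mp h0).symm
        (sub_eq_zero.mp ((mul_eq_zero.mp h).resolve_left hup)).symm)
    · refine hv (Finset.mem_image.mpr ⟨(p, q), Finset.mk_mem_product hp hq, ?_⟩)
      field_simp
      linarith
  have hzP : !₂[u, v] ∉ P := fun h => hu (Finset.mem_image.mpr ⟨_, h, by simp⟩)
  refine ⟨!₂[u, v], hzP, fun p hp q hq s hs hpq hps hqs => ?_⟩
  rw [Finset.mem_insert] at hp hq hs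
  rcases hp with rfl | hp
  · rw [cross_rotate]
    exact hz q (hq.resolve_left hpq.symm) s (hs.resolve_left hps.symm) hqs
  rcases hq with rfl | hq
  · rw [cross_rotate, cross_rotate]
    exact hz s (hs.resolve_left hqs.symm) p hp hps.symm
  rcases hs with rfl | hs
  · exact hz p hp q hq hpq
  · exact hP p hp q hq s hs hpq hps hqs

theorem NoThreeCollinear.exists_superset {P : Finset Pt} (hP : NoThreeCollinear P) (d : ℕ) :
    ∃ P', P ⊆ P' ∧ P'.card = P.card + d ∧ NoThreeCollinear P' := by
  induction d with
  | zero => exact ⟨P, subset_rfl, rfl, hP⟩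
  | succ d ih =>
    obtain ⟨P', hPP', hc, hP'⟩ := ih
    obtain ⟨z, hz, hzP'⟩ := hP'.exists_insert
    exact ⟨insert z P', hPP'.trans (Finset.subset_insert z P'),
      by rw [Finset.card_insert_of_notMem hz]; omega, hzP'⟩

/-- Three concurrent lines cut a set of at most `3 * k` points in general position into alternating
sextants of sizes at most `s` and `t`, where `s + t = k`. -/
theorem NoThreeCollinear.exists_sextant_card_le {P : Finset Pt} (hP : NoThreeCollinear P) {k : ℕ}
    (hk : 0 < k) (hPk : P.card ≤ 3 * k) :
    ∃ (a b : Fin 3 → ℝ) (o : Pt) (s t : ℕ), ∑ i, a i = 0 ∧ ∑ i, b i = 0 ∧ s + t = k ∧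
      (∀ i, ∀ p ∈ P, linForm (a i) (b i) o p ≠ 0) ∧ (∀ i, (sextant a b o P i).card ≤ s) ∧
      ∀ i, (sextant (-a) (-b) o P i).card ≤ t := by
  obtain ⟨P', hPP', hcard, hP'⟩ := hP.exists_superset (3 * k - P.card)
  have hxz : ∀ i j l : P', i ≠ j → i ≠ l → j ≠ l →
      cross (fun p : P' => p.1 0) (fun p => p.1 1) i j l ≠ 0 := fun i j l hij hil hjl =>
    hP' i i.2 j j.2 l l.2 (Subtype.coe_ne_coe.mpr hij) (Subtype.coe_ne_coe.mpr hil)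
      (Subtype.coe_ne_coe.mpr hjl)
  obtain ⟨c, y, hy, hinj, hgen⟩ := exists_generic_shear (fun i j hij =>
    Subtype.ext (ext_of_coords (Prod.ext_iff.mp hij).1 (Prod.ext_iff.mp hij).2)) hxz
  obtain ⟨A, B, a, h, s, t, hA, hB, hst, hne, hs, ht⟩ := exists_sextant_partition
    (x := fun p : P' => p.1 0) hk (by rw [Fintype.card_coe]; omega) hinj
    (fun i j l => by rw [funext hy, cross_add_mul]; exact hxz i j l) hgen
  have hform : ∀ (j : Fin 3) (p : P'),
      linForm (A j + c * B j) (B j) !₂[a, h - c * a] p.1 = A j * (p.1 0 - a) + B j * (y p - h) :=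
    fun j p => by
      rw [hy]
      simp only [linForm, Matrix.cons_val_zero, Matrix.cons_val_one]
      ring
  refine ⟨fun j => A j + c * B j, B, !₂[a, h - c * a], s, t, ?_, hB, hst, fun i p hp => ?_,
    fun m => ?_, fun m => ?_⟩
  · rw [Finset.sum_add_distrib, ← Finset.mul_sum, hA, hB, mul_zero, add_zero]
  · exact (hform i ⟨p, hPP' hp⟩).trans_ne (hne i ⟨p, hPP' hp⟩)
  · rw [← hs m]
    refine Finset.card_le_card_of_surjOn Subtype.val fun p hp => ?_
    obtain ⟨hpP, hp⟩ := Finset.mem_filter.mp hp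
    refine ⟨⟨p, hPP' hpP⟩, ?_, rfl⟩
    simpa [← hform] using hp
  · rw [← ht m]
    refine Finset.card_le_card_of_surjOn Subtype.val fun p hp => ?_
    obtain ⟨hpP, hp⟩ := Finset.mem_filter.mp hp
    refine ⟨⟨p, hPP' hpP⟩, ?_, rfl⟩
    simp only [Finset.mem_coe, Finset.mem_filter, Finset.mem_univ, true_and, ← hform]
    intro j
    rw [← hp j, Pi.neg_apply, Pi.neg_apply, linForm_neg, neg_pos]

/-- If no three points of `P` are collinear and no four are concyclic, then `P` can be
identified by at most `2⌈n/6⌉ + 1` disks. -/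
theorem upper_bound_general_position (P : Finset Pt)
    (hcol : ∀ p ∈ P, ∀ q ∈ P, ∀ s ∈ P, p ≠ q → p ≠ s → q ≠ s →
      ¬ Collinear ℝ ({p, q, s} : Set Pt))
    (hcyc : ∀ p ∈ P, ∀ q ∈ P, ∀ s ∈ P, ∀ t ∈ P,
      p ≠ q → p ≠ s → p ≠ t → q ≠ s → q ≠ t → s ≠ t →
      ¬ ∃ (c : Pt) (ρ : ℝ), p ∈ Metric.sphere c ρ ∧ q ∈ Metric.sphere c ρ ∧
        s ∈ Metric.sphere c ρ ∧ t ∈ Metric.sphere c ρ) :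
    ∃ 𝒟 : Finset (Set Pt), (∀ D ∈ 𝒟, IsDisk D) ∧ Identifies 𝒟 P ∧
      𝒟.card ≤ 2 * ((P.card + 5) / 6) + 1 := by
  rcases P.eq_empty_or_nonempty with rfl | hne
  · exact ⟨∅, by simp, by simp [Identifies], by simp⟩
  have hpos := hne.card_pos
  have hP : NoThreeCollinear P := fun p hp q hq s hs hpq hps hqs h =>
    hcol p hp q hq s hs hpq hps hqs (collinear_of_cross_eq_zero hpq h)
  obtain ⟨a, b, o, s, t, ha, hb, hst, hne, hs, ht⟩ :=
    hP.exists_sextant_card_le (k := 2 * ((P.card + 5) / 6)) (by omega) (by omega)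
  obtain ⟨𝒟, h𝒟, hid, hcard⟩ :=
    exists_identifying_of_sextants hcyc ha hb hne (by omega) hs ht
  exact ⟨𝒟, h𝒟, hid, by omega⟩
end
end
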